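/- For each n ≥ 1 let p_n be a probability distribution on the positive integers and X_n a random variable with distribution p_n; assume μ_n := E[log X_n] and σ_n² := Var(log X_n) satisfy 0 < μ_n < ∞ and 0 < σ_n < ∞, and set ξ_n = (log X_n − μ_n)/σ_n. Assume the Lindeberg-type condition: for every ε > 0, lim_{n→∞} E[ξ_n²·1{ξ_n² > ε·(log n)/μ_n}] = 0. Set t_n = (3·log n)/(2·μ_n) and b_n = (1/μ_n)·max{1, √(σ_n²·(log n)/μ_n)}. Then b_n/t_n → 0, lim_{c→+∞} limsup_{n→∞} ‖Q_{n,p_n}^{⌈t_n + c·b_n⌉} − U_n‖_TV = 0, and lim_{c→+∞} liminf_{n→∞} ‖Q_{n,p_n}^{max(⌊t_n − c·b_n⌋,0)} − U_n‖_TV = 1. Moreover, if inf_n b_n > 0, then the cutoff is optimal: for every c > 0, liminf_{n→∞} ‖Q_{n,p_n}^{⌈t_n + c·b_n⌉} − U_n‖_TV > 0 and limsup_{n→∞} ‖Q_{n,p_n}^{max(⌊t_n − c·b_n⌋,0)} − U_n‖_TV < 1. -/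

import Mathlib

open Filter MeasureTheory
open scoped BigOperators NNReal ENNReal

noncomputable section

/-- The value of `σ⁻¹` at position `i` (0-indexed), as a natural number; `0` out of range. -/
def invAt (n : ℕ) (σ : Equiv.Perm (Fin n)) (i : ℕ) : ℕ :=
  if h : i < n then ((σ⁻¹ ⟨i, h⟩ : Fin n) : ℕ) else 0

/-- The number of rising sequences of a permutation: one plus the number of descents
of its inverse. -/
def rSeq (n : ℕ) (σ : Equiv.Perm (Fin n)) : ℕ :=
  1 + ((Finset.range (n - 1)).filter fun i => invAt n σ (i + 1) < invAt n σ i).card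

/-- The `m`-shuffle distribution on `S_n`:  `Q_{n,m}(σ) = m^{-n} C(n + m - r(σ), n)`. -/
def Qs (n m : ℕ) (σ : Equiv.Perm (Fin n)) : ℝ :=
  ((m : ℝ) ^ n)⁻¹ * (Nat.choose (n + m - rSeq n σ) n : ℝ)

/-- The uniform distribution on `S_n`. -/
def Us (n : ℕ) (_ : Equiv.Perm (Fin n)) : ℝ := (n.factorial : ℝ)⁻¹

/-- Total variation distance between two probability distributions on `S_n`. -/
def tv (n : ℕ) (μ ν : Equiv.Perm (Fin n) → ℝ) : ℝ :=
  (1 / 2) * ∑ σ : Equiv.Perm (Fin n), |μ σ - ν σ|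

/-- Convolution of two distributions on `S_n`. -/
def convol (n : ℕ) (μ ν : Equiv.Perm (Fin n) → ℝ) : Equiv.Perm (Fin n) → ℝ :=
  fun σ => ∑ τ : Equiv.Perm (Fin n), μ (σ * τ⁻¹) * ν τ

/-- `k`-fold convolution power; the `0`-th power is the point mass at the identity. -/
def iterConv (n : ℕ) (μ : Equiv.Perm (Fin n) → ℝ) : ℕ → Equiv.Perm (Fin n) → ℝ
  | 0 => fun σ => if σ = 1 then 1 else 0
  | k + 1 => convol n μ (iterConv n μ k)

/-- `Ψ(x) = (2π)^{-1/2} ∫_{-x/(4√3)}^{x/(4√3)} e^{-t²/2} dt`. -/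
def Psi (x : ℝ) : ℝ :=
  (Real.sqrt (2 * Real.pi))⁻¹ *
    ∫ t in (-(x / (4 * Real.sqrt 3)))..(x / (4 * Real.sqrt 3)), Real.exp (-t ^ 2 / 2)

/-- The `p`-shuffle distribution on `S_n` for a probability `p` on the positive integers. -/
def Qp (n : ℕ) (p : ℕ → ℝ) (σ : Equiv.Perm (Fin n)) : ℝ := ∑' m : ℕ, p m * Qs n m σ

/-! ### Shuffles as sorted words -/

section SortedWords

variable {α β : Type} [LinearOrder α] [LinearOrder β] {n : ℕ}

lemma sort_comp_orderIso (e : α ≃o β) (w : Fin n → α) :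
    Tuple.sort (e ∘ w) = Tuple.sort w := by
  symm
  rw [Tuple.eq_sort_iff]
  obtain ⟨h1, h2⟩ := Tuple.eq_sort_iff.1 (rfl : Tuple.sort w = Tuple.sort w)
  refine ⟨fun i j hij => e.monotone (h1 hij), fun i j hij h => h2 i j hij ?_⟩
  exact e.injective h

/-- The word over `α ×ₗ β` obtained from a word over `β` and a word over `α` indexed by the
positions in the list sorted according to the former. -/
def lexWord (u : Fin n → α) (v : Fin n → β) (i : Fin n) : α ×ₗ β :=
  toLex (u ((Tuple.sort v)⁻¹ i), v i)

lemma sort_lexWord (u : Fin n → α) (v : Fin n → β) :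
    Tuple.sort (lexWord u v) = Tuple.sort v * Tuple.sort u := by
  symm
  rw [Tuple.eq_sort_iff]
  obtain ⟨hu1, hu2⟩ := Tuple.eq_sort_iff.1 (rfl : Tuple.sort u = Tuple.sort u)
  obtain ⟨hv1, hv2⟩ := Tuple.eq_sort_iff.1 (rfl : Tuple.sort v = Tuple.sort v)
  have key : ∀ j, lexWord u v ((Tuple.sort v * Tuple.sort u) j)
      = toLex (u (Tuple.sort u j), v (Tuple.sort v (Tuple.sort u j))) := by
    intro j; simp [lexWord]
  constructor
  · intro i j hij
    rcases hij.eq_or_lt with rfl | hlt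
    · rfl
    simp only [Function.comp_apply, key, Prod.Lex.toLex_le_toLex]
    rcases (hu1 hij).lt_or_eq with h | h
    · exact Or.inl h
    · exact Or.inr ⟨h, hv1 (hu2 i j hlt h).le⟩
  · intro i j hij h
    rw [key, key] at h
    have heq := toLex.injective h
    rw [Prod.mk.injEq] at heq
    exact hv2 _ _ (hu2 i j hij heq.1) heq.2

/-- The number of words of length `n` over `α` whose stable sorting permutation is `π`. -/
def sortCount (α : Type) [LinearOrder α] [Fintype α] {n : ℕ} (π : Equiv.Perm (Fin n)) : ℕ :=
  (Finset.univ.filter fun w : Fin n → α => Tuple.sort w = π).card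

variable [Fintype α] [Fintype β]

lemma sum_sortCount : ∑ π : Equiv.Perm (Fin n), sortCount α π = Fintype.card α ^ n := by
  have h := Finset.card_eq_sum_card_fiberwise (s := (Finset.univ : Finset (Fin n → α)))
    (t := (Finset.univ : Finset (Equiv.Perm (Fin n)))) (f := fun w => Tuple.sort w)
    (fun _ _ => by simp)
  simpa [sortCount] using h.symm

lemma sortCount_congr (e : α ≃o β) (π : Equiv.Perm (Fin n)) :
    sortCount α π = sortCount β π := by
  refine Finset.card_bij (fun w _ => e ∘ w) ?_ ?_ ?_
  · intro w hw
    simpa [sort_comp_orderIso] using hw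
  · intro a _ b _ h
    exact e.injective.comp_left h
  · intro w hw
    refine ⟨e.symm ∘ w, ?_, ?_⟩
    · simpa [sort_comp_orderIso] using hw
    · ext i; simp

lemma sortCount_lex (π : Equiv.Perm (Fin n)) :
    sortCount (α ×ₗ β) π
      = ∑ ρ : Equiv.Perm (Fin n), sortCount α (ρ⁻¹ * π) * sortCount β ρ := by
  have h1 : sortCount (α ×ₗ β) π = (Finset.univ.filter
      fun x : (Fin n → α) × (Fin n → β) => Tuple.sort x.2 * Tuple.sort x.1 = π).card := by
    symm
    refine Finset.card_bij (fun x _ => lexWord x.1 x.2) ?_ ?_ ?_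
    · intro x hx
      simpa [sort_lexWord] using hx
    · rintro ⟨a, b⟩ _ ⟨a', b'⟩ _ h
      have hb : b = b' := by
        funext i
        have := congrFun h i
        simp only [lexWord] at this
        exact (Prod.mk.inj (toLex.injective this)).2
      subst hb
      have ha : a = a' := by
        funext i
        have := congrFun h (Tuple.sort b i)
        simp only [lexWord] at this
        simpa using (Prod.mk.inj (toLex.injective this)).1
      rw [ha]
    · intro w hw
      let v : Fin n → β := fun i => (ofLex (w i)).2
      let u : Fin n → α := fun i => (ofLex (w (Tuple.sort v i))).1
      have : lexWord u v = w := by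
        funext i; simp [lexWord, u, v]
      refine ⟨(u, v), ?_, this⟩
      rw [Finset.mem_filter] at hw ⊢
      exact ⟨Finset.mem_univ _, by rw [← sort_lexWord, this]; exact hw.2⟩
  rw [h1, Finset.card_eq_sum_card_fiberwise (t := Finset.univ)
    (f := fun x => Tuple.sort x.2) (fun _ _ => by simp)]
  refine Finset.sum_congr rfl fun ρ _ => ?_
  rw [sortCount, sortCount, ← Finset.card_product]
  congr 1
  ext ⟨u, v⟩
  simp only [Finset.mem_filter, Finset.mem_univ, true_and, Finset.mem_product]
  constructor
  · rintro ⟨h, rfl⟩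
    exact ⟨by rw [← h]; simp, rfl⟩
  · rintro ⟨h, rfl⟩
    exact ⟨by rw [h]; simp, rfl⟩

/-- The number of ascents `j < i` of the sequence of values of `π`. -/
def ascBelow (π : Equiv.Perm (Fin n)) (i : ℕ) : ℕ :=
  ((Finset.range i).filter fun j => ¬ invAt n π⁻¹ (j + 1) < invAt n π⁻¹ j).card

lemma ascBelow_succ (π : Equiv.Perm (Fin n)) (i : ℕ) :
    ascBelow π (i + 1)
      = ascBelow π i + if invAt n π⁻¹ (i + 1) < invAt n π⁻¹ i then 0 else 1 := by
  unfold ascBelow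
  rw [Finset.range_add_one, Finset.filter_insert]
  split_ifs <;> simp_all

lemma invAt_inv (π : Equiv.Perm (Fin n)) {i : ℕ} (h : i < n) :
    invAt n π⁻¹ i = (π ⟨i, h⟩ : ℕ) := by
  simp [invAt, h]

lemma ascBelow_add_rSeq (π : Equiv.Perm (Fin n)) (hn : 1 ≤ n) :
    ascBelow π (n - 1) + rSeq n π⁻¹ = n := by
  have h := Finset.card_filter_add_card_filter_not (s := Finset.range (n - 1))
    (fun i => invAt n π⁻¹ (i + 1) < invAt n π⁻¹ i)
  rw [Finset.card_range] at h
  unfold ascBelow rSeq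
  omega

lemma fin_strictMono_of_succ {γ : Type*} [Preorder γ] (f : Fin n → γ)
    (h : ∀ i (hi : i + 1 < n), f ⟨i, by omega⟩ < f ⟨i + 1, hi⟩) : StrictMono f := by
  cases n with
  | zero => exact fun i => i.elim0
  | succ n =>
    rw [Fin.strictMono_iff_lt_succ]
    intro i
    exact h i (by omega)

lemma sort_eq_iff {m : ℕ} (w : Fin n → Fin m) (π : Equiv.Perm (Fin n)) :
    Tuple.sort w = π ↔ StrictMono fun i : Fin n => (w (π i) : ℕ) + ascBelow π i := by
  rw [eq_comm, Tuple.eq_sort_iff]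
  constructor
  · rintro ⟨h1, h2⟩
    refine fin_strictMono_of_succ _ fun i hi => ?_
    have hle : (w (π ⟨i, by omega⟩) : ℕ) ≤ w (π ⟨i + 1, hi⟩) :=
      h1 (a := ⟨i, by omega⟩) (b := ⟨i + 1, hi⟩) (by simp)
    have h3 := h2 ⟨i, by omega⟩ ⟨i + 1, hi⟩ (by simp)
    simp only [ascBelow_succ, invAt_inv π hi, invAt_inv π (show i < n by omega)]
    split_ifs with hd
    · rcases hle.lt_or_eq with h | h
      · omega
      · exact absurd (h3 (Fin.ext h)) (by simpa using hd.le)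
    · omega
  · intro h
    have hlt : StrictMono fun i : Fin n => toLex (w (π i), π i) := by
      refine fin_strictMono_of_succ _ fun i hi => ?_
      have h3 := h (a := ⟨i, by omega⟩) (b := ⟨i + 1, hi⟩) (by simp)
      simp only [ascBelow_succ, invAt_inv π hi, invAt_inv π (show i < n by omega)] at h3
      rw [Prod.Lex.toLex_lt_toLex]
      simp only [Fin.lt_def, Fin.ext_iff]
      have hne : (π ⟨i, by omega⟩ : ℕ) ≠ π ⟨i + 1, hi⟩ := by
        intro h; simpa using π.injective (Fin.ext h)
      split_ifs at h3 <;> omega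
    refine ⟨fun i j hij => ?_, fun i j hij he => ?_⟩
    · rcases hij.eq_or_lt with rfl | hij
      · rfl
      rcases Prod.Lex.toLex_lt_toLex.1 (hlt hij) with h | h
      · exact h.le
      · exact h.1.le
    · rcases Prod.Lex.toLex_lt_toLex.1 (hlt hij) with h | h
      · exact absurd he h.ne
      · exact h.2

lemma ascBelow_mono (π : Equiv.Perm (Fin n)) : Monotone (ascBelow π) := by
  refine monotone_nat_of_le_succ fun i => ?_
  rw [ascBelow_succ]; omega

lemma ascBelow_le (π : Equiv.Perm (Fin n)) (i : ℕ) : ascBelow π i ≤ i :=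
  (Finset.card_filter_le _ _).trans (by simp)

lemma sortCount_fin (m : ℕ) (π : Equiv.Perm (Fin n)) (hn : 1 ≤ n) :
    sortCount (Fin m) π = (n + m - rSeq n π⁻¹).choose n := by
  set M := n + m - rSeq n π⁻¹ with hM
  have hr := ascBelow_add_rSeq π hn
  have hM' : M = m + ascBelow π (n - 1) := by omega
  rw [show M.choose n = (Finset.powersetCard n (Finset.range M)).card by simp]
  refine Finset.card_bij
    (fun w _ => Finset.univ.image fun i : Fin n => (w (π i) : ℕ) + ascBelow π i) ?_ ?_ ?_
  · intro w hw
    rw [Finset.mem_filter, sort_eq_iff] at hw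
    rw [Finset.mem_powersetCard]
    refine ⟨fun x hx => ?_, ?_⟩
    · obtain ⟨i, -, rfl⟩ := Finset.mem_image.1 hx
      have := ascBelow_mono π (show (i : ℕ) ≤ n - 1 by omega)
      have := (w (π i)).2
      rw [Finset.mem_range]; omega
    · rw [Finset.card_image_of_injective _ hw.2.injective]; simp
  · intro w hw w' hw' h
    rw [Finset.mem_filter, sort_eq_iff] at hw hw'
    have := (StrictMono.range_inj hw.2 hw'.2).1 (by
      simpa [Finset.coe_image] using congrArg (fun s : Finset ℕ => (s : Set ℕ)) h)
    funext i
    have h' := congrFun this (π⁻¹ i)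
    simp only [show π (π⁻¹ i) = i by simp] at h'
    exact Fin.ext (by omega)
  · intro S hS
    rw [Finset.mem_powersetCard] at hS
    let e := S.orderEmbOfFin hS.2
    have hstep : ∀ i (hi : i + 1 < n), e ⟨i, by omega⟩ < e ⟨i + 1, hi⟩ :=
      fun i hi => e.strictMono (by simp)
    have hge : ∀ i (hi : i < n), i ≤ e ⟨i, hi⟩ := by
      intro i
      induction i with
      | zero => simp
      | succ i ih =>
        intro hi
        have := hstep i hi
        have := ih (by omega)
        omega
    have hmem : ∀ i, e i < M := fun i =>
      Finset.mem_range.1 (hS.1 (S.orderEmbOfFin_mem hS.2 i))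
    have hlt : ∀ d i (hi : i < n), i + d = n - 1 → e ⟨i, hi⟩ < m + ascBelow π i := by
      intro d
      induction d with
      | zero =>
        intro i hi h
        have := hmem ⟨i, hi⟩
        have h' : i = n - 1 := by omega
        rw [hM', ← h'] at this
        exact this
      | succ d ih =>
        intro i hi h
        have h1 := hstep i (by omega)
        have h2 := ih (i + 1) (by omega) (by omega)
        rw [ascBelow_succ] at h2
        split_ifs at h2 <;> omega
    have hval : ∀ i : Fin n, e i - ascBelow π i < m := by
      intro i
      have := hlt (n - 1 - i) i i.2 (by omega)
      have := hge i i.2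
      have := ascBelow_le π i
      simp only [Fin.eta] at *
      omega
    let w : Fin n → Fin m := fun i => ⟨e (π⁻¹ i) - ascBelow π (π⁻¹ i), hval _⟩
    have hw : (fun i : Fin n => (w (π i) : ℕ) + ascBelow π i) = e := by
      funext i
      have := hge i i.2
      have := ascBelow_le π i
      simp only [w, show π⁻¹ (π i) = i by simp, Fin.eta] at *
      omega
    refine ⟨w, ?_, ?_⟩
    · rw [Finset.mem_filter, sort_eq_iff, hw]
      exact ⟨Finset.mem_univ _, e.strictMono⟩
    · rw [hw]
      apply Finset.coe_injective
      simp [e]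

end SortedWords

/-! ### The shuffle distributions -/

lemma Qs_eq_sortCount {n : ℕ} (hn : 1 ≤ n) (m : ℕ) (σ : Equiv.Perm (Fin n)) :
    Qs n m σ = ((m : ℝ) ^ n)⁻¹ * sortCount (Fin m) σ⁻¹ := by
  rw [Qs, sortCount_fin m σ⁻¹ hn, inv_inv]

lemma Qs_nonneg (n m : ℕ) (σ : Equiv.Perm (Fin n)) : 0 ≤ Qs n m σ := by
  unfold Qs; positivity

lemma sum_Qs {n m : ℕ} (hn : 1 ≤ n) (hm : 1 ≤ m) : ∑ σ, Qs n m σ = 1 := by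
  simp_rw [Qs_eq_sortCount hn, ← Finset.mul_sum]
  rw [show ∑ σ : Equiv.Perm (Fin n), (sortCount (Fin m) σ⁻¹ : ℝ) = ∑ σ, (sortCount (Fin m) σ : ℝ)
    from Equiv.sum_comp (Equiv.inv (Equiv.Perm (Fin n))) fun σ => (sortCount (Fin m) σ : ℝ)]
  rw [← Nat.cast_sum, sum_sortCount]
  have : (m : ℝ) ≠ 0 := by positivity
  simp [this]

lemma convol_Qs {n : ℕ} (hn : 1 ≤ n) (m m' : ℕ) :
    convol n (Qs n m) (Qs n m') = Qs n (m * m') := by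
  funext σ
  have e : Fin m ×ₗ Fin m' ≃o Fin (m * m') :=
    (Fintype.orderIsoFinOfCardEq _ (by simp [Lex])).symm
  unfold convol
  simp_rw [Qs_eq_sortCount hn]
  rw [← sortCount_congr e, sortCount_lex, Nat.cast_sum, Finset.mul_sum,
    ← Equiv.sum_comp (Equiv.inv (Equiv.Perm (Fin n)))]
  refine Finset.sum_congr rfl fun ρ _ => ?_
  simp only [Equiv.inv_apply, inv_inv, mul_inv_rev]
  push_cast
  rw [mul_pow, mul_inv]
  ring

/-- The one-step mass bound. -/
lemma Qs_le_one {n m : ℕ} (hn : 1 ≤ n) (σ : Equiv.Perm (Fin n)) : Qs n m σ ≤ 1 := by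
  rcases Nat.eq_zero_or_pos m with rfl | hm
  · simp [Qs, show n ≠ 0 by omega]
  · rw [← sum_Qs hn hm]
    exact Finset.single_le_sum (fun σ _ => Qs_nonneg n m σ) (Finset.mem_univ σ)

/-! ### The density of the `m`-shuffle with respect to the uniform distribution -/

/-- The density of the `m`-shuffle with respect to the uniform distribution, as a function of the
number `r` of rising sequences. -/
def shuffleDens (n m r : ℕ) : ℝ := ∏ i ∈ Finset.range n, (1 + ((i : ℝ) + 1 - r) / m)

lemma one_le_rSeq (n : ℕ) (σ : Equiv.Perm (Fin n)) : 1 ≤ rSeq n σ := by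
  unfold rSeq; omega

lemma rSeq_le {n : ℕ} (hn : 1 ≤ n) (σ : Equiv.Perm (Fin n)) : rSeq n σ ≤ n := by
  unfold rSeq
  have := Finset.card_filter_le (Finset.range (n - 1))
    fun i => invAt n σ (i + 1) < invAt n σ i
  rw [Finset.card_range] at this
  omega

lemma shuffleDens_eq_zero {n m r : ℕ} (hm : 1 ≤ m) (hr : r ≤ n) (h : m < r) :
    shuffleDens n m r = 0 := by
  refine Finset.prod_eq_zero (i := r - m - 1) (by rw [Finset.mem_range]; omega) ?_
  have h1 : ((r - m - 1 : ℕ) : ℝ) + 1 = r - m := by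
    rw [eq_sub_iff_add_eq]
    exact_mod_cast (by omega : r - m - 1 + 1 + m = r)
  have h2 : (m : ℝ) ≠ 0 := by positivity
  rw [h1]
  field_simp
  ring

lemma shuffleDens_factor_nonneg {m r : ℕ} (h : r ≤ m) (i : ℕ) :
    0 ≤ 1 + ((i : ℝ) + 1 - r) / m := by
  rcases Nat.eq_zero_or_pos m with rfl | hm
  · simp
  have h2 : (0 : ℝ) < m := by positivity
  have h3 : (r : ℝ) ≤ m := by exact_mod_cast h
  rw [← neg_le_iff_add_nonneg', le_div_iff₀ h2]
  have : (0 : ℝ) ≤ i := by positivity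
  linarith

lemma Qs_eq_shuffleDens {n m : ℕ} (hn : 1 ≤ n) (hm : 1 ≤ m) (σ : Equiv.Perm (Fin n)) :
    Qs n m σ = (n.factorial : ℝ)⁻¹ * shuffleDens n m (rSeq n σ) := by
  have hr := rSeq_le hn σ
  have hr1 := one_le_rSeq n σ
  unfold Qs
  generalize rSeq n σ = r at *
  rcases lt_or_ge m r with h | h
  · rw [shuffleDens_eq_zero hm hr h, Nat.choose_eq_zero_of_lt (by omega)]
    simp
  · have h0 : (m : ℝ) ≠ 0 := by positivity
    have h1 : (n.factorial : ℝ) ≠ 0 := by positivity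
    have h2 : (n.factorial : ℝ) * ((n + m - r).choose n : ℝ)
        = ∏ i ∈ Finset.range n, ((m : ℝ) - r + 1 + i) := by
      rw [show n + m - r = (m - r) + n by omega, ← Nat.cast_mul,
        ← Nat.ascFactorial_eq_factorial_mul_choose, Nat.ascFactorial_eq_prod_range]
      push_cast [Nat.cast_sub h]
      rfl
    have h3 : shuffleDens n m r * (m : ℝ) ^ n = ∏ i ∈ Finset.range n, ((m : ℝ) - r + 1 + i) := by
      rw [shuffleDens, ← Finset.card_range n, ← Finset.prod_const, Finset.card_range,
        ← Finset.prod_mul_distrib]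
      refine Finset.prod_congr rfl fun i _ => ?_
      field_simp
      ring
    rw [← h3] at h2
    field_simp
    linarith

lemma shuffleDens_nonneg {n m r : ℕ} (hm : 1 ≤ m) (hr : r ≤ n) : 0 ≤ shuffleDens n m r := by
  rcases lt_or_ge m r with h | h
  · rw [shuffleDens_eq_zero hm hr h]
  · exact Finset.prod_nonneg fun i _ => shuffleDens_factor_nonneg h i

lemma shuffleDens_anti {n m r s : ℕ} (hm : 1 ≤ m) (hrs : r ≤ s) (hs : s ≤ n) :
    shuffleDens n m s ≤ shuffleDens n m r := by
  rcases lt_or_ge m s with h | h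
  · rw [shuffleDens_eq_zero hm hs h]
    exact shuffleDens_nonneg hm (hrs.trans hs)
  · refine Finset.prod_le_prod (fun i _ => shuffleDens_factor_nonneg h i) fun i _ => ?_
    have : (r : ℝ) ≤ s := by exact_mod_cast hrs
    gcongr

lemma shuffleDens_cross {n m M r s : ℕ} (hm : 1 ≤ m) (hmM : m ≤ M) (hrs : r ≤ s) (hs : s ≤ n) :
    shuffleDens n M r * shuffleDens n m s ≤ shuffleDens n m r * shuffleDens n M s := by
  have hr := hrs.trans hs
  rcases lt_or_ge m s with h | h
  · rw [shuffleDens_eq_zero hm hs h, mul_zero]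
    exact mul_nonneg (shuffleDens_nonneg hm hr) (shuffleDens_nonneg (hm.trans hmM) hs)
  · unfold shuffleDens
    rw [← Finset.prod_mul_distrib, ← Finset.prod_mul_distrib]
    refine Finset.prod_le_prod (fun i _ => mul_nonneg
      (shuffleDens_factor_nonneg (by omega) i) (shuffleDens_factor_nonneg h i)) fun i _ => ?_
    have h1 : (r : ℝ) ≤ s := by exact_mod_cast hrs
    have h2 : (m : ℝ) ≤ M := by exact_mod_cast hmM
    have h3 : (1 : ℝ) ≤ m := by exact_mod_cast hm
    have h4 : (M : ℝ)⁻¹ ≤ (m : ℝ)⁻¹ := by gcongr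
    simp only [div_eq_mul_inv]
    nlinarith [mul_nonneg (sub_nonneg.2 h1) (sub_nonneg.2 h4)]

lemma sum_sq_sub_ge (n : ℕ) (r : ℝ) :
    ((n : ℝ) ^ 3 - n) / 12 ≤ ∑ i ∈ Finset.range n, ((i : ℝ) + 1 - r) ^ 2 := by
  have h : ∑ i ∈ Finset.range n, ((i : ℝ) + 1 - r) ^ 2
      = n * (r - (n + 1) / 2) ^ 2 + ((n : ℝ) ^ 3 - n) / 12 := by
    induction n with
    | zero => simp
    | succ n ih =>
      rw [Finset.sum_range_succ, ih]
      push_cast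
      ring
  rw [h]
  have : (0 : ℝ) ≤ n * (r - (n + 1) / 2) ^ 2 := by positivity
  linarith

lemma one_add_sum_le_prod_one_add (n : ℕ) (c : ℕ → ℝ) (hc : ∀ i, 0 ≤ c i) :
    1 + ∑ i ∈ Finset.range n, c i ≤ ∏ i ∈ Finset.range n, (1 + c i) := by
  induction n with
  | zero => simp
  | succ n ih =>
    rw [Finset.sum_range_succ, Finset.prod_range_succ]
    have := Finset.sum_nonneg fun i (_ : i ∈ Finset.range n) => hc i
    nlinarith [hc n, mul_nonneg this (hc n)]

lemma shuffleDens_mul_le_sq {n m r : ℕ} (hm : 1 ≤ m) (hr1 : 1 ≤ r) (hr : r ≤ n) :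
    shuffleDens n m r * (1 + ((n : ℝ) ^ 3 - n) / (48 * m * (m + n)))
      ≤ shuffleDens n (2 * m) r ^ 2 := by
  rcases lt_or_ge m r with h | h
  · rw [shuffleDens_eq_zero hm hr h, zero_mul]
    positivity
  have hm0 : (0 : ℝ) < m := by exact_mod_cast hm
  have hn0 : (0 : ℝ) ≤ n := by positivity
  have hrm : (r : ℝ) ≤ m := by exact_mod_cast h
  have hr1' : (1 : ℝ) ≤ r := by exact_mod_cast hr1
  have h1 : 1 + ((n : ℝ) ^ 3 - n) / (48 * m * (m + n))
      ≤ ∏ i ∈ Finset.range n, (1 + ((i : ℝ) + 1 - r) ^ 2 / (4 * m * (m + n))) := by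
    refine le_trans ?_ (one_add_sum_le_prod_one_add n _ fun i => by positivity)
    rw [← Finset.sum_div]
    have := sum_sq_sub_ge n r
    have h2 : ((n : ℝ) ^ 3 - n) / (48 * m * (m + n))
        = ((n : ℝ) ^ 3 - n) / 12 / (4 * m * (m + n)) := by
      field_simp; ring
    rw [h2]
    gcongr
  refine (mul_le_mul_of_nonneg_left h1 (shuffleDens_nonneg hm hr)).trans ?_
  unfold shuffleDens
  rw [← Finset.prod_mul_distrib, ← Finset.prod_pow]
  refine Finset.prod_le_prod (fun i _ => mul_nonneg (shuffleDens_factor_nonneg h i)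
    (by positivity)) fun i hi => ?_
  have hi' : (i : ℝ) + 1 ≤ n := by exact_mod_cast Finset.mem_range.1 hi
  set z : ℝ := (i : ℝ) + 1 - r with hz
  have hi0 : (0 : ℝ) ≤ i := by positivity
  have hmz : 0 < (m : ℝ) + z := by linarith
  have h3 : z ^ 2 / (4 * m * (m + n)) ≤ z ^ 2 / (4 * m * (m + z)) := by
    gcongr
    linarith
  have h4 : 0 ≤ 1 + z / m := shuffleDens_factor_nonneg h i
  calc (1 + z / m) * (1 + z ^ 2 / (4 * m * (m + n)))
      ≤ (1 + z / m) * (1 + z ^ 2 / (4 * m * (m + z))) := by gcongr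
    _ = (1 + z / ((2 * m : ℕ) : ℝ)) ^ 2 := by
      push_cast
      field_simp
      ring

lemma shuffleDens_sq_le {n m r : ℕ} (hn : 1 ≤ n) (hm : 8 * n ≤ m) (hr1 : 1 ≤ r) (hr : r ≤ n) :
    shuffleDens n m r ^ 2
      ≤ shuffleDens n (m / 2) r * Real.exp (8 * (n : ℝ) ^ 3 / m ^ 2) := by
  have hn1 : (1 : ℝ) ≤ n := by exact_mod_cast hn
  have hm8 : 8 * (n : ℝ) ≤ m := by exact_mod_cast hm
  have hm0 : (0 : ℝ) < m := by linarith
  set q := m / 2 with hq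
  have hq1 : 2 * (q : ℝ) ≤ m := by exact_mod_cast (by omega : 2 * q ≤ m)
  have hq2 : (m : ℝ) ≤ 2 * q + 1 := by exact_mod_cast (by omega : m ≤ 2 * q + 1)
  have hq0 : (0 : ℝ) < q := by linarith
  have hexp : Real.exp (8 * (n : ℝ) ^ 3 / m ^ 2)
      = ∏ _i ∈ Finset.range n, Real.exp (8 * (n : ℝ) ^ 2 / m ^ 2) := by
    rw [Finset.prod_const, Finset.card_range, ← Real.exp_nat_mul]
    congr 1
    ring
  rw [hexp]
  unfold shuffleDens
  rw [← Finset.prod_mul_distrib, ← Finset.prod_pow]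
  refine Finset.prod_le_prod (fun i _ => by positivity) fun i hi => ?_
  have hi' : (i : ℝ) + 1 ≤ n := by exact_mod_cast Finset.mem_range.1 hi
  have hr1' : (1 : ℝ) ≤ r := by exact_mod_cast hr1
  have hr' : (r : ℝ) ≤ n := by exact_mod_cast hr
  have hi0 : (0 : ℝ) ≤ i := by positivity
  set y : ℝ := (i : ℝ) + 1 - r with hy
  have hy1 : y ≤ n := by linarith
  have hy2 : -n ≤ y := by linarith
  have hpos : 1 / 2 ≤ 1 + y / q := by
    have : -(1 / 2) ≤ y / q := by
      rw [le_div_iff₀ hq0]; linarith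
    linarith
  have h1 : (1 + y / m) ^ 2 ≤ (1 + y / q) * (1 + 8 * (n : ℝ) ^ 2 / m ^ 2) := by
    have h2 : (1 + y / m) ^ 2 = 1 + y / q + (y ^ 2 / m ^ 2 - y * (m - 2 * q) / (m * q)) := by
      field_simp; ring
    have h3 : y ^ 2 / m ^ 2 ≤ (n : ℝ) ^ 2 / m ^ 2 := by
      gcongr ?_ / _
      exact sq_le_sq' hy2 hy1
    have h4 : - (y * (m - 2 * q) / (m * q)) ≤ 3 * (n : ℝ) ^ 2 / m ^ 2 := by
      rw [← neg_div, div_le_div_iff₀ (by positivity) (by positivity)]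
      have h5 : -(y * (m - 2 * q)) ≤ n := by nlinarith
      have h6 : (m : ℝ) ≤ 3 * q := by linarith
      calc -(y * (m - 2 * q)) * (m : ℝ) ^ 2 ≤ (n : ℝ) * (m : ℝ) ^ 2 := by gcongr
        _ ≤ (n : ℝ) ^ 2 * ((m : ℝ) * (3 * q)) := by
          rw [sq (m : ℝ)]
          gcongr
          nlinarith
        _ = _ := by ring
    have h7 : 4 * (n : ℝ) ^ 2 / m ^ 2 ≤ (1 + y / q) * (8 * (n : ℝ) ^ 2 / m ^ 2) := by
      have : (1 / 2) * (8 * (n : ℝ) ^ 2 / m ^ 2) ≤ (1 + y / q) * (8 * (n : ℝ) ^ 2 / m ^ 2) := by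
        gcongr
      calc _ = (1 / 2) * (8 * (n : ℝ) ^ 2 / m ^ 2) := by ring
        _ ≤ _ := this
    have h8 : (n : ℝ) ^ 2 / m ^ 2 + 3 * (n : ℝ) ^ 2 / m ^ 2 = 4 * (n : ℝ) ^ 2 / m ^ 2 := by ring
    rw [h2, mul_add, mul_one]
    linarith
  refine h1.trans ?_
  have : 0 ≤ 1 + y / q := by linarith
  gcongr
  rw [add_comm]
  exact Real.add_one_le_exp _

/-! ### Total variation estimates for the `m`-shuffles -/

lemma Us_pos (n : ℕ) (σ : Equiv.Perm (Fin n)) : 0 < Us n σ := by unfold Us; positivity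

lemma sum_Us (n : ℕ) : ∑ σ, Us n σ = 1 := by
  have : (n.factorial : ℝ) ≠ 0 := by positivity
  simp [Us, Fintype.card_perm, this]

lemma tv_nonneg (n : ℕ) (P Q : Equiv.Perm (Fin n) → ℝ) : 0 ≤ tv n P Q := by
  unfold tv; positivity

lemma tv_eq_one_sub {n : ℕ} {P Q : Equiv.Perm (Fin n) → ℝ} (hP : ∑ σ, P σ = 1)
    (hQ : ∑ σ, Q σ = 1) : tv n P Q = 1 - ∑ σ, min (P σ) (Q σ) := by
  have h : ∀ σ, |P σ - Q σ| = P σ + Q σ - 2 * min (P σ) (Q σ) := by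
    intro σ
    rcases le_total (P σ) (Q σ) with h | h
    · rw [min_eq_left h, abs_of_nonpos (by linarith)]; ring
    · rw [min_eq_right h, abs_of_nonneg (by linarith)]; ring
  simp_rw [tv, h, Finset.sum_sub_distrib, Finset.sum_add_distrib, hP, hQ, ← Finset.mul_sum]
  ring

lemma tv_le_one {n : ℕ} {P Q : Equiv.Perm (Fin n) → ℝ} (hP : ∑ σ, P σ = 1)
    (hQ : ∑ σ, Q σ = 1) (hP0 : ∀ σ, 0 ≤ P σ) (hQ0 : ∀ σ, 0 ≤ Q σ) : tv n P Q ≤ 1 := by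
  rw [tv_eq_one_sub hP hQ]
  have := Finset.sum_nonneg fun σ (_ : σ ∈ Finset.univ) => le_min (hP0 σ) (hQ0 σ)
  linarith

lemma sum_sub_le_tv {n : ℕ} {P Q : Equiv.Perm (Fin n) → ℝ} (hP : ∑ σ, P σ = 1)
    (hQ : ∑ σ, Q σ = 1) (A : Finset (Equiv.Perm (Fin n))) :
    ∑ σ ∈ A, (P σ - Q σ) ≤ tv n P Q := by
  have h1 := Finset.sum_add_sum_compl A fun σ => P σ - Q σ
  have h2 : ∑ σ, (P σ - Q σ) = 0 := by rw [Finset.sum_sub_distrib, hP, hQ, sub_self]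
  have h3 := Finset.sum_add_sum_compl A fun σ => |P σ - Q σ|
  have h4 : ∑ σ ∈ A, (P σ - Q σ) ≤ ∑ σ ∈ A, |P σ - Q σ| :=
    Finset.sum_le_sum fun σ _ => le_abs_self _
  have h5 : -∑ σ ∈ Aᶜ, (P σ - Q σ) ≤ ∑ σ ∈ Aᶜ, |P σ - Q σ| := by
    rw [← Finset.sum_neg_distrib]
    exact Finset.sum_le_sum fun σ _ => neg_le_abs _
  unfold tv
  linarith

lemma tv_eq_sum_filter {n : ℕ} {P Q : Equiv.Perm (Fin n) → ℝ} (hP : ∑ σ, P σ = 1)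
    (hQ : ∑ σ, Q σ = 1) :
    tv n P Q = ∑ σ ∈ Finset.univ.filter (fun σ => Q σ < P σ), (P σ - Q σ) := by
  rw [tv_eq_one_sub hP hQ, ← hP, ← Finset.sum_sub_distrib, Finset.sum_filter]
  refine Finset.sum_congr rfl fun σ _ => ?_
  split_ifs with h
  · rw [min_eq_right h.le]
  · rw [min_eq_left (not_lt.1 h), sub_self]

/-- Monotone likelihood ratio implies domination on the corresponding event. -/
lemma sum_le_sum_of_cross {ι : Type*} [Fintype ι] [DecidableEq ι] {P Q : ι → ℝ}
    (hP : ∑ i, P i = 1) (hQ : ∑ i, Q i = 1) (A : Finset ι)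
    (h : ∀ i ∈ A, ∀ j ∉ A, Q i * P j ≤ P i * Q j) : ∑ i ∈ A, Q i ≤ ∑ i ∈ A, P i := by
  have h1 : (∑ i ∈ A, Q i) * ∑ j ∈ Aᶜ, P j ≤ (∑ i ∈ A, P i) * ∑ j ∈ Aᶜ, Q j := by
    rw [Finset.sum_mul_sum, Finset.sum_mul_sum]
    exact Finset.sum_le_sum fun i hi => Finset.sum_le_sum fun j hj =>
      h i hi j (Finset.mem_compl.1 hj)
  have h2 := Finset.sum_add_sum_compl A P
  have h3 := Finset.sum_add_sum_compl A Q
  rw [hP] at h2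
  rw [hQ] at h3
  rw [← eq_sub_iff_add_eq'] at h2 h3
  rw [h2, h3] at h1
  linarith

/-- The event on which the `M`-shuffle charges more than the uniform distribution. -/
def excessSet (n M : ℕ) : Finset (Equiv.Perm (Fin n)) :=
  Finset.univ.filter fun σ => Us n σ < Qs n M σ

lemma rSeq_le_of_excessSet {n M : ℕ} (hn : 1 ≤ n) (hM : 1 ≤ M) {σ τ : Equiv.Perm (Fin n)}
    (hσ : σ ∈ excessSet n M) (hτ : τ ∉ excessSet n M) : rSeq n σ ≤ rSeq n τ := by
  by_contra hlt
  have h1 : Qs n M σ ≤ Qs n M τ := by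
    rw [Qs_eq_shuffleDens hn hM, Qs_eq_shuffleDens hn hM]
    have := shuffleDens_anti hM (not_le.1 hlt).le (rSeq_le hn σ)
    gcongr
  simp only [excessSet, Finset.mem_filter, Finset.mem_univ, true_and, not_lt] at hσ hτ
  have : Us n σ = Us n τ := rfl
  linarith

lemma sum_Us_le_sum_Qs {n m M : ℕ} (hn : 1 ≤ n) (hm : 1 ≤ m) (hM : 1 ≤ M) :
    ∑ σ ∈ excessSet n M, Us n σ ≤ ∑ σ ∈ excessSet n M, Qs n m σ := by
  refine sum_le_sum_of_cross (sum_Qs hn hm) (sum_Us n) _ fun σ hσ τ hτ => ?_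
  have := shuffleDens_anti hm (rSeq_le_of_excessSet hn hM hσ hτ) (rSeq_le hn τ)
  rw [Qs_eq_shuffleDens hn hm, Qs_eq_shuffleDens hn hm, Us, Us, mul_comm]
  gcongr

lemma sum_Qs_le_sum_Qs {n m M : ℕ} (hn : 1 ≤ n) (hm : 1 ≤ m) (hmM : m ≤ M) :
    ∑ σ ∈ excessSet n M, Qs n M σ ≤ ∑ σ ∈ excessSet n M, Qs n m σ := by
  have hM := hm.trans hmM
  refine sum_le_sum_of_cross (sum_Qs hn hm) (sum_Qs hn hM) _ fun σ hσ τ hτ => ?_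
  have := shuffleDens_cross hm hmM (rSeq_le_of_excessSet hn hM hσ hτ) (rSeq_le hn τ)
  simp only [Qs_eq_shuffleDens hn hm, Qs_eq_shuffleDens hn hM]
  rw [mul_mul_mul_comm, mul_mul_mul_comm _ _ _ (shuffleDens n M _)]
  gcongr

lemma excess_ge_tv {n m M : ℕ} (hn : 1 ≤ n) (hm : 1 ≤ m) (hmM : m ≤ M) :
    tv n (Qs n M) (Us n) ≤ ∑ σ ∈ excessSet n M, (Qs n m σ - Us n σ) := by
  rw [tv_eq_sum_filter (sum_Qs hn (hm.trans hmM)) (sum_Us n), Finset.sum_sub_distrib,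
    Finset.sum_sub_distrib]
  exact sub_le_sub_right (sum_Qs_le_sum_Qs hn hm hmM) _

lemma excess_nonneg {n m M : ℕ} (hn : 1 ≤ n) (hm : 1 ≤ m) (hM : 1 ≤ M) :
    0 ≤ ∑ σ ∈ excessSet n M, (Qs n m σ - Us n σ) := by
  rw [Finset.sum_sub_distrib]
  exact sub_nonneg.2 (sum_Us_le_sum_Qs hn hm hM)

lemma tv_Qs_ge {n m : ℕ} (hn : 1 ≤ n) (hm : 1 ≤ m) {x : ℝ} (hx0 : 0 ≤ x)
    (hx : x ≤ ((n : ℝ) ^ 3 - n) / (48 * m * (m + n))) :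
    1 - (Real.sqrt (1 + x))⁻¹ ≤ tv n (Qs n m) (Us n) := by
  rw [tv_eq_one_sub (sum_Qs hn hm) (sum_Us n)]
  refine sub_le_sub_left ?_ 1
  calc ∑ σ, min (Qs n m σ) (Us n σ) ≤ ∑ σ, Qs n (2 * m) σ * (Real.sqrt (1 + x))⁻¹ := by
        refine Finset.sum_le_sum fun σ _ => ?_
        rw [← div_eq_mul_inv, le_div_iff₀ (by positivity)]
        refine le_of_sq_le_sq ?_ (Qs_nonneg _ _ _)
        rw [mul_pow, Real.sq_sqrt (by positivity)]
        have hr := rSeq_le hn σ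
        have hr1 := one_le_rSeq n σ
        have h1 := shuffleDens_mul_le_sq hm hr1 hr
        have h0 := shuffleDens_nonneg hm hr
        have hmin : min (Qs n m σ) (Us n σ) ^ 2 ≤ Qs n m σ * Us n σ := by
          rw [sq]
          exact mul_le_mul (min_le_left _ _) (min_le_right _ _)
            (le_min (Qs_nonneg _ _ _) (Us_pos n σ).le) (Qs_nonneg _ _ _)
        refine (mul_le_mul_of_nonneg_right hmin (by positivity)).trans ?_
        rw [Qs_eq_shuffleDens hn hm, Qs_eq_shuffleDens hn (by omega), Us, mul_pow]
        calc _ = ((n.factorial : ℝ)⁻¹) ^ 2 * (shuffleDens n m (rSeq n σ) * (1 + x)) := by ring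
          _ ≤ _ := by
            gcongr
            refine le_trans ?_ h1
            gcongr
    _ = (Real.sqrt (1 + x))⁻¹ := by
        rw [← Finset.sum_mul, sum_Qs hn (by omega), one_mul]

lemma one_le_one_sub_tv_mul {n m : ℕ} (hn : 1 ≤ n) (hm : 8 * n ≤ m) {V : ℝ}
    (hV : Real.exp (8 * (n : ℝ) ^ 3 / m ^ 2) ≤ V) :
    1 ≤ (1 - tv n (Qs n m) (Us n)) * (V + tv n (Qs n m) (Us n)) := by
  have hm1 : 1 ≤ m := by omega
  have hfac : (0 : ℝ) < n.factorial := by positivity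
  have hsq : (∑ σ, Qs n m σ) ^ 2 ≤ (∑ σ, min (Qs n m σ) (Us n σ)) *
      ∑ σ, (n.factorial : ℝ) * (Qs n m σ * max (Qs n m σ) (Us n σ)) := by
    refine Finset.sum_sq_le_sum_mul_sum_of_sq_le_mul _
      (fun σ _ => le_min (Qs_nonneg _ _ _) (Us_pos n σ).le)
      (fun σ _ => mul_nonneg hfac.le (mul_nonneg (Qs_nonneg _ _ _)
        (le_max_of_le_right (Us_pos n σ).le))) fun σ _ => le_of_eq ?_
    calc Qs n m σ ^ 2 = (n.factorial : ℝ) * Qs n m σ * (Qs n m σ * Us n σ) := by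
          unfold Us; field_simp
      _ = (n.factorial : ℝ) * Qs n m σ *
          (min (Qs n m σ) (Us n σ) * max (Qs n m σ) (Us n σ)) := by rw [min_mul_max]
      _ = _ := by ring
  have hmin : 1 - tv n (Qs n m) (Us n) = ∑ σ, min (Qs n m σ) (Us n σ) := by
    rw [tv_eq_one_sub (sum_Qs hn hm1) (sum_Us n)]; ring
  rw [sum_Qs hn hm1, one_pow, ← hmin] at hsq
  have hmin0 : 0 ≤ 1 - tv n (Qs n m) (Us n) := by
    rw [hmin]
    exact Finset.sum_nonneg fun σ _ => le_min (Qs_nonneg _ _ _) (Us_pos n σ).le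
  refine hsq.trans (mul_le_mul_of_nonneg_left ?_ hmin0)
  have hterm : ∀ σ, (n.factorial : ℝ) * (Qs n m σ * max (Qs n m σ) (Us n σ))
      ≤ Qs n (m / 2) σ * Real.exp (8 * (n : ℝ) ^ 3 / m ^ 2)
        + (Us n σ - min (Qs n m σ) (Us n σ)) := by
    intro σ
    have h1 : (n.factorial : ℝ) * Qs n m σ ^ 2
        ≤ Qs n (m / 2) σ * Real.exp (8 * (n : ℝ) ^ 3 / m ^ 2) := by
      have := shuffleDens_sq_le hn hm (one_le_rSeq n σ) (rSeq_le hn σ)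
      rw [Qs_eq_shuffleDens hn hm1, Qs_eq_shuffleDens hn (by omega : 1 ≤ m / 2), mul_pow]
      calc _ = (n.factorial : ℝ)⁻¹ * shuffleDens n m (rSeq n σ) ^ 2 := by field_simp
        _ ≤ _ := by rw [mul_assoc]; gcongr
    have hU : (n.factorial : ℝ) * Us n σ = 1 := by unfold Us; field_simp
    rcases le_total (Us n σ) (Qs n m σ) with h | h
    · rw [max_eq_left h, min_eq_right h]
      linarith [sq (Qs n m σ)]
    · rw [max_eq_right h, min_eq_left h]
      have h2 : (n.factorial : ℝ) * (Qs n m σ * Us n σ) = Qs n m σ := by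
        rw [mul_left_comm, hU, mul_one]
      have h3 : (n.factorial : ℝ) * (Us n σ - Qs n m σ) ^ 2 ≥ 0 := by positivity
      have h4 : (n.factorial : ℝ) * (Us n σ - Qs n m σ) ^ 2
          = Us n σ - 2 * Qs n m σ + n.factorial * Qs n m σ ^ 2 := by
        calc _ = n.factorial * Us n σ * Us n σ - 2 * (n.factorial * (Qs n m σ * Us n σ))
              + n.factorial * Qs n m σ ^ 2 := by ring
          _ = _ := by rw [hU, h2, one_mul]
      linarith
  calc ∑ σ, (n.factorial : ℝ) * (Qs n m σ * max (Qs n m σ) (Us n σ))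
      ≤ ∑ σ, (Qs n (m / 2) σ * Real.exp (8 * (n : ℝ) ^ 3 / m ^ 2)
        + (Us n σ - min (Qs n m σ) (Us n σ))) := Finset.sum_le_sum fun σ _ => hterm σ
    _ = Real.exp (8 * (n : ℝ) ^ 3 / m ^ 2) + tv n (Qs n m) (Us n) := by
      rw [Finset.sum_add_distrib, ← Finset.sum_mul, sum_Qs hn (by omega : 1 ≤ m / 2),
        Finset.sum_sub_distrib, sum_Us, ← hmin]
      ring
    _ ≤ _ := by gcongr

lemma tv_Qs_le_sqrt {n m : ℕ} (hn : 1 ≤ n) (hm : 8 * n ≤ m) {V : ℝ}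
    (hV : Real.exp (8 * (n : ℝ) ^ 3 / m ^ 2) ≤ V) :
    tv n (Qs n m) (Us n) ≤ Real.sqrt (V - 1) := by
  have h := one_le_one_sub_tv_mul hn hm hV
  have h0 := tv_nonneg n (Qs n m) (Us n)
  have h1 : 1 ≤ V := (Real.one_le_exp (by positivity)).trans hV
  refine Real.le_sqrt_of_sq_le ?_
  nlinarith [mul_nonneg h0 (sub_nonneg.2 h1)]

lemma tv_Qs_le_one_sub {n m : ℕ} (hn : 1 ≤ n) (hm : 8 * n ≤ m) {V : ℝ}
    (hV : Real.exp (8 * (n : ℝ) ^ 3 / m ^ 2) ≤ V) :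
    tv n (Qs n m) (Us n) ≤ 1 - (V + 1)⁻¹ := by
  have h := one_le_one_sub_tv_mul hn hm hV
  have hle := tv_le_one (sum_Qs hn (by omega : 1 ≤ m)) (sum_Us n) (Qs_nonneg n m)
    fun σ => (Us_pos n σ).le
  have h1 : 1 ≤ V := (Real.one_le_exp (by positivity)).trans hV
  rw [le_sub_comm, inv_le_iff_one_le_mul₀ (by linarith)]
  nlinarith [mul_nonneg (sub_nonneg.2 hle) (sub_nonneg.2 hle)]

section Mixture

open ProbabilityTheory

/-- The measure on `ℕ` with mass `q k` at `k`. -/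
def massLaw (q : ℕ → ℝ) : Measure ℕ :=
  Measure.sum fun k => ENNReal.ofReal (q k) • Measure.dirac k

lemma integrable_massLaw {q : ℕ → ℝ} (hq : ∀ k, 0 ≤ q k) {g : ℕ → ℝ} :
    Integrable g (massLaw q) ↔ Summable fun k => q k * |g k| := by
  rw [massLaw, integrable_sum_dirac_iff (by simp)]
  simp_rw [ENNReal.toReal_ofReal (hq _), Real.norm_eq_abs]

lemma integral_massLaw {q : ℕ → ℝ} (hq : ∀ k, 0 ≤ q k) (g : ℕ → ℝ) :
    ∫ k, g k ∂massLaw q = ∑' k, q k * g k := by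
  rw [massLaw, integral_sum_dirac (by simp)]
  simp_rw [ENNReal.toReal_ofReal (hq _), smul_eq_mul]

lemma isProbabilityMeasure_massLaw {q : ℕ → ℝ} (hq : ∀ k, 0 ≤ q k) (hq1 : ∑' k, q k = 1) :
    IsProbabilityMeasure (massLaw q) := by
  have hs : Summable q := by
    by_contra h
    simp [tsum_eq_zero_of_not_summable h] at hq1
  constructor
  rw [massLaw, Measure.sum_apply _ MeasurableSet.univ]
  simp [← ENNReal.ofReal_tsum_of_nonneg hq hs, hq1]

lemma ae_one_le_massLaw {q : ℕ → ℝ} (hq0 : q 0 = 0) : ∀ᵐ k ∂massLaw q, 1 ≤ k := by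
  rw [massLaw, Measure.ae_sum_iff]
  intro k
  rcases Nat.eq_zero_or_pos k with rfl | hk
  · simp [hq0]
  · exact Measure.ae_smul_measure
      (by simpa [ae_dirac_iff, Nat.one_le_iff_ne_zero] using Nat.pos_iff_ne_zero.1 hk) _

/-- The shuffle with a random number `N` of piles. -/
def mixQs {Ω : Type*} [MeasurableSpace Ω] (n : ℕ) (P : Measure Ω) (N : Ω → ℕ) (σ : Equiv.Perm (Fin n)) : ℝ :=
  ∫ ω, Qs n (N ω) σ ∂P

lemma mixQs_nonneg {Ω : Type*} [MeasurableSpace Ω] {P : Measure Ω} (n : ℕ) (N : Ω → ℕ) (σ : Equiv.Perm (Fin n)) : 0 ≤ mixQs n P N σ :=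
  integral_nonneg fun _ => Qs_nonneg _ _ _

variable {Ω : Type*} [MeasurableSpace Ω] {P : Measure Ω} [IsProbabilityMeasure P]

lemma integrable_Qs_comp {n : ℕ} (hn : 1 ≤ n) {N : Ω → ℕ} (hN : Measurable N)
    (σ : Equiv.Perm (Fin n)) : Integrable (fun ω => Qs n (N ω) σ) P := by
  refine Integrable.of_bound
    ((measurable_from_nat (f := fun m => Qs n m σ)).comp hN).aestronglyMeasurable 1 ?_
  filter_upwards with ω
  rw [Real.norm_eq_abs, abs_of_nonneg (Qs_nonneg _ _ _)]
  exact Qs_le_one hn σ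

lemma sum_mixQs_finset {n : ℕ} (hn : 1 ≤ n) {N : Ω → ℕ} (hN : Measurable N)
    (A : Finset (Equiv.Perm (Fin n))) :
    ∑ σ ∈ A, (mixQs n P N σ - Us n σ) = ∫ ω, ∑ σ ∈ A, (Qs n (N ω) σ - Us n σ) ∂P := by
  rw [integral_finsetSum _ fun σ _ => by
    exact (integrable_Qs_comp hn hN σ).sub (integrable_const (Us n σ))]
  refine Finset.sum_congr rfl fun σ _ => ?_
  rw [integral_sub (integrable_Qs_comp hn hN σ) (integrable_const _)]
  simp [mixQs]

lemma sum_mixQs {n : ℕ} (hn : 1 ≤ n) {N : Ω → ℕ} (hN : Measurable N)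
    (hN1 : ∀ᵐ ω ∂P, 1 ≤ N ω) : ∑ σ, mixQs n P N σ = 1 := by
  simp only [mixQs]
  rw [← integral_finsetSum _ fun σ _ => integrable_Qs_comp hn hN σ]
  rw [integral_congr_ae (g := fun _ => (1 : ℝ))]
  · simp
  · filter_upwards [hN1] with ω hω using sum_Qs hn hω

lemma tv_mixQs_le {n : ℕ} (hn : 1 ≤ n) {N : Ω → ℕ} (hN : Measurable N)
    (hN1 : ∀ᵐ ω ∂P, 1 ≤ N ω) {M : ℕ} {δ : ℝ}
    (hM : ∀ m, 1 ≤ m → M ≤ m → tv n (Qs n m) (Us n) ≤ 1 - δ) :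
    tv n (mixQs n P N) (Us n) ≤ 1 - δ * P.real {ω | M ≤ N ω} := by
  have hint : ∀ σ, Integrable (fun ω => Qs n (N ω) σ - Us n σ) P := fun σ =>
    (integrable_Qs_comp hn hN σ).sub (integrable_const _)
  have hset : MeasurableSet {ω | M ≤ N ω} := hN measurableSet_Ici
  have h1 : tv n (mixQs n P N) (Us n) ≤ ∫ ω, tv n (Qs n (N ω)) (Us n) ∂P := by
    unfold tv
    rw [integral_const_mul, integral_finsetSum _ fun σ _ => (hint σ).abs]
    gcongr with σ
    rw [show mixQs n P N σ - Us n σ = ∫ ω, (Qs n (N ω) σ - Us n σ) ∂P by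
      rw [integral_sub (integrable_Qs_comp hn hN σ) (integrable_const _)]; simp [mixQs]]
    exact abs_integral_le_integral_abs
  have hind : Integrable ({ω | M ≤ N ω}.indicator fun _ => δ) P :=
    (integrable_const δ).indicator hset
  have h2 : ∫ ω, tv n (Qs n (N ω)) (Us n) ∂P
      ≤ ∫ ω, (1 - {ω | M ≤ N ω}.indicator (fun _ => δ) ω) ∂P := by
    refine integral_mono_ae ?_ ((integrable_const _).sub hind) ?_
    · exact (integrable_finsetSum _ fun σ _ => (hint σ).abs).const_mul _
    · filter_upwards [hN1] with ω hω
      by_cases h : M ≤ N ω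
      · simpa [Set.indicator, h] using hM _ hω h
      · simpa [Set.indicator, h] using tv_le_one (sum_Qs hn hω) (sum_Us n) (Qs_nonneg n _)
          fun σ => (Us_pos n σ).le
  refine (h1.trans h2).trans_eq ?_
  rw [integral_sub (integrable_const _) hind, integral_indicator hset]
  simp [mul_comm]

lemma le_tv_mixQs {n : ℕ} (hn : 1 ≤ n) {N : Ω → ℕ} (hN : Measurable N)
    (hN1 : ∀ᵐ ω ∂P, 1 ≤ N ω) {M : ℕ} (hM : 1 ≤ M) :
    P.real {ω | N ω ≤ M} * tv n (Qs n M) (Us n) ≤ tv n (mixQs n P N) (Us n) := by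
  have hset : MeasurableSet {ω | N ω ≤ M} := hN measurableSet_Iic
  refine le_trans ?_ (sum_sub_le_tv (sum_mixQs hn hN hN1) (sum_Us n) (excessSet n M))
  rw [sum_mixQs_finset hn hN]
  calc P.real {ω | N ω ≤ M} * tv n (Qs n M) (Us n)
      = ∫ ω, {ω | N ω ≤ M}.indicator (fun _ => tv n (Qs n M) (Us n)) ω ∂P := by
        rw [integral_indicator hset]; simp
    _ ≤ _ := by
        refine integral_mono_ae ((integrable_const _).indicator hset)
          (integrable_finsetSum _ fun σ _ =>
            (integrable_Qs_comp hn hN σ).sub (integrable_const _)) ?_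
        filter_upwards [hN1] with ω hω
        by_cases h : N ω ≤ M
        · simpa [Set.indicator, h] using excess_ge_tv hn hω h
        · simpa [Set.indicator, h] using excess_nonneg hn hω hM

lemma tv_mixQs_le_one {n : ℕ} (hn : 1 ≤ n) {N : Ω → ℕ} (hN : Measurable N)
    (hN1 : ∀ᵐ ω ∂P, 1 ≤ N ω) : tv n (mixQs n P N) (Us n) ≤ 1 :=
  tv_le_one (sum_mixQs hn hN hN1) (sum_Us n) (mixQs_nonneg n N) fun σ => (Us_pos n σ).le

lemma Qs_one {n : ℕ} (hn : 1 ≤ n) (σ : Equiv.Perm (Fin n)) :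
    Qs n 1 σ = if σ = 1 then 1 else 0 := by
  have h1 : Qs n 1 1 = 1 := by
    have : rSeq n 1 = 1 := by
      rw [rSeq, Finset.card_eq_zero.2, add_zero]
      rw [Finset.filter_eq_empty_iff]
      intro i hi
      have hi : i < n - 1 := Finset.mem_range.1 hi
      simp [invAt, show i < n by omega, show i + 1 < n by omega]
    simp [Qs, this]
  split_ifs with h
  · rw [h, h1]
  · have hs := sum_Qs hn le_rfl
    rw [← Finset.add_sum_erase _ _ (Finset.mem_univ 1), h1, add_eq_left,
      Finset.sum_eq_zero_iff_of_nonneg fun _ _ => Qs_nonneg _ _ _] at hs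
    exact hs σ (by simp [h])

lemma iterConv_Qp_eq_mixQs {n : ℕ} (hn : 1 ≤ n) {q : ℕ → ℝ} (hq : ∀ k, 0 ≤ q k)
    {X : ℕ → Ω → ℕ} (hX : ∀ i, Measurable (X i)) (hlaw : ∀ i, HasLaw (X i) (massLaw q) P)
    (hind : iIndepFun X P) (k : ℕ) :
    iterConv n (Qp n q) k = mixQs n P (∏ i ∈ Finset.range k, X i) := by
  have hprod : ∀ k, Measurable (∏ i ∈ Finset.range k, X i) := fun k => by
    simpa only [← Finset.prod_apply] using! Finset.measurable_prod (Finset.range k) fun i _ => hX i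
  induction k with
  | zero =>
    funext σ
    simp [iterConv, mixQs, Qs_one hn]
  | succ k ih =>
    have hQp : ∀ σ, Qp n q σ = ∫ ω, Qs n (X k ω) σ ∂P := by
      intro σ
      have := (hlaw k).integral_comp (f := fun m => Qs n m σ)
        measurable_from_nat.aestronglyMeasurable
      rw [integral_massLaw hq] at this
      exact this.symm
    funext σ
    rw [iterConv, ih, convol]
    have hI : IndepFun (X k) (∏ i ∈ Finset.range k, X i) P :=
      (hind.indepFun_prod_range_succ hX k).symm
    have hterm : ∀ τ, Qp n q (σ * τ⁻¹) * mixQs n P (∏ i ∈ Finset.range k, X i) τ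
        = ∫ ω, Qs n (X k ω) (σ * τ⁻¹) * Qs n ((∏ i ∈ Finset.range k, X i) ω) τ ∂P := by
      intro τ
      rw [hQp, mixQs]
      exact (hI.integral_fun_comp_mul_comp (f := fun m => Qs n m (σ * τ⁻¹))
        (g := fun m => Qs n m τ) (hX k).aemeasurable (hprod k).aemeasurable
        measurable_from_nat.aestronglyMeasurable measurable_from_nat.aestronglyMeasurable).symm
    simp_rw [hterm]
    rw [← integral_finsetSum]
    · refine integral_congr_ae (.of_forall fun ω => ?_)
      have := congrFun (convol_Qs hn (X k ω) ((∏ i ∈ Finset.range k, X i) ω)) σ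
      simp only [convol] at this
      simp only [this, Finset.prod_range_succ, Pi.mul_apply, mul_comm]
    · intro τ _
      refine (integrable_Qs_comp hn (hprod k) τ).bdd_mul (c := 1)
        (integrable_Qs_comp hn (hX k) _).aestronglyMeasurable (.of_forall fun ω => ?_)
      rw [Real.norm_eq_abs, abs_of_nonneg (Qs_nonneg _ _ _)]
      exact Qs_le_one hn _

end Mixture

section Lindeberg

open ProbabilityTheory Topology

lemma norm_pow_sub_pow_le_mul {a b : ℂ} (ha : ‖a‖ ≤ 1) (hb : ‖b‖ ≤ 1) (k : ℕ) :
    ‖a ^ k - b ^ k‖ ≤ k * ‖a - b‖ := by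
  induction k with
  | zero => simp
  | succ k ih =>
    have : a ^ (k + 1) - b ^ (k + 1) = a * (a ^ k - b ^ k) + (a - b) * b ^ k := by ring
    rw [this]
    refine (norm_add_le _ _).trans ?_
    rw [norm_mul, norm_mul, norm_pow]
    have h1 : ‖a‖ * ‖a ^ k - b ^ k‖ ≤ 1 * (k * ‖a - b‖) := by gcongr
    have h2 : ‖a - b‖ * ‖b‖ ^ k ≤ ‖a - b‖ * 1 := by
      gcongr; exact pow_le_one₀ (norm_nonneg _) hb
    push_cast
    linarith

lemma norm_exp_sub_taylor_le (u : ℝ) :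
    ‖Complex.exp (u * Complex.I) - (1 + u * Complex.I - (u : ℂ) ^ 2 / 2)‖
      ≤ 4 * u ^ 2 * min 1 |u| := by
  rcases le_total |u| 1 with h | h
  · rw [min_eq_right h]
    have hx : ‖(u * Complex.I : ℂ)‖ = |u| := by simp
    have := Complex.exp_bound (x := u * Complex.I) (by rw [hx]; exact h) (n := 3) (by norm_num)
    rw [hx] at this
    have h2 : ∑ m ∈ Finset.range 3, (u * Complex.I : ℂ) ^ m / m.factorial
        = 1 + u * Complex.I - (u : ℂ) ^ 2 / 2 := by
      simp [Finset.sum_range_succ, mul_pow, Nat.factorial]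
      ring
    rw [h2] at this
    refine this.trans ?_
    have h3 : |u| ^ 3 = u ^ 2 * |u| := by rw [pow_succ, sq_abs]
    rw [h3]
    have : 0 ≤ u ^ 2 * |u| := by positivity
    norm_num [Nat.factorial]
    linarith
  · rw [min_eq_left h]
    have h1 : ‖Complex.exp (u * Complex.I)‖ = 1 := Complex.norm_exp_ofReal_mul_I u
    have h2 : ‖(1 + u * Complex.I - (u : ℂ) ^ 2 / 2)‖ ≤ 1 + |u| + u ^ 2 / 2 := by
      refine (norm_sub_le _ _).trans ?_
      gcongr
      · refine (norm_add_le _ _).trans ?_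
        simp
      · simp
    have h3 := norm_sub_le (Complex.exp (u * Complex.I)) (1 + u * Complex.I - (u : ℂ) ^ 2 / 2)
    have h4 : 1 ≤ u ^ 2 := by rw [← sq_abs]; nlinarith
    have h5 : |u| ≤ u ^ 2 := by rw [← sq_abs]; nlinarith
    linarith

lemma norm_charFun_sub_le {ρ : Measure ℝ} [IsProbabilityMeasure ρ]
    (h1 : Integrable (fun x => x) ρ) (h2 : Integrable (fun x => x ^ 2) ρ)
    (hm : ∫ x, x ∂ρ = 0) (hv : ∫ x, x ^ 2 ∂ρ = 1) {k : ℝ} (hk : 0 < k) (θ : ℝ)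
    {ε L : ℝ} (hε : 0 ≤ ε) (hL : L ≤ k) :
    ‖charFun ρ ((√k)⁻¹ * θ) - ((1 - θ ^ 2 / (2 * k) : ℝ) : ℂ)‖
      ≤ 4 * θ ^ 2 / k * (|θ| * √ε + ∫ x, (if ε * L < x ^ 2 then x ^ 2 else 0) ∂ρ) := by
  set s := (√k)⁻¹ * θ with hs
  have hs2 : s ^ 2 = θ ^ 2 / k := by
    rw [hs, mul_pow, inv_pow, Real.sq_sqrt hk.le]; field_simp
  have hi2 : Integrable (fun x => if ε * L < x ^ 2 then x ^ 2 else 0) ρ :=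
    (h2.indicator (s := {x | ε * L < x ^ 2})
      (measurableSet_lt measurable_const (by fun_prop))).congr (.of_forall fun x => by
        simp [Set.indicator])
  have hT : ∫ x, (1 + (s * x : ℝ) * Complex.I - ((s * x : ℝ) : ℂ) ^ 2 / 2) ∂ρ
      = ((1 - θ ^ 2 / (2 * k) : ℝ) : ℂ) := by
    have e1 : Integrable (fun x : ℝ => ((s * x : ℝ) : ℂ) * Complex.I) ρ :=
      ((h1.const_mul s).ofReal).mul_const _
    have e2 : Integrable (fun x : ℝ => (((s ^ 2 / 2) * x ^ 2 : ℝ) : ℂ)) ρ :=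
      (h2.const_mul _).ofReal
    have : ∀ x : ℝ, (1 + (s * x : ℝ) * Complex.I - ((s * x : ℝ) : ℂ) ^ 2 / 2)
        = 1 + (s * x : ℝ) * Complex.I - (((s ^ 2 / 2) * x ^ 2 : ℝ) : ℂ) := by
      intro x; push_cast; ring
    simp_rw [this]
    have e3 : Integrable (fun x : ℝ => 1 + ((s * x : ℝ) : ℂ) * Complex.I) ρ :=
      (integrable_const _).add e1
    rw [integral_sub e3 e2, integral_add (integrable_const _) e1,
      integral_mul_const, integral_complex_ofReal, integral_complex_ofReal, integral_const_mul,
      integral_const_mul, hm, hv, hs2]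
    simp
    ring
  have hTint : Integrable (fun x : ℝ =>
      (1 + (s * x : ℝ) * Complex.I - ((s * x : ℝ) : ℂ) ^ 2 / 2)) ρ := by
    have e2 : Integrable (fun x : ℝ => ((s * x : ℝ) : ℂ) ^ 2 / 2) ρ := by
      refine ((h2.const_mul (s ^ 2 / 2)).ofReal (𝕜 := ℂ)).congr (.of_forall fun x => ?_)
      change ((s ^ 2 / 2 * x ^ 2 : ℝ) : ℂ) = _
      push_cast; ring
    exact ((integrable_const _).add (((h1.const_mul s).ofReal).mul_const _)).sub e2
  have hEint : Integrable (fun x : ℝ => Complex.exp ((s * x : ℝ) * Complex.I)) ρ := by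
    refine Integrable.of_bound (by fun_prop) 1 (.of_forall fun x => ?_)
    rw [Complex.norm_exp_ofReal_mul_I]
  have hc : charFun ρ s = ∫ x, Complex.exp ((s * x : ℝ) * Complex.I) ∂ρ := by
    rw [charFun_apply_real]; simp
  rw [hc, ← hT, ← integral_sub hEint hTint]
  have hbd : ∫ x, (4 * θ ^ 2 / k * (|θ| * √ε * x ^ 2
      + (if ε * L < x ^ 2 then x ^ 2 else 0))) ∂ρ
      = 4 * θ ^ 2 / k * (|θ| * √ε + ∫ x, (if ε * L < x ^ 2 then x ^ 2 else 0) ∂ρ) := by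
    rw [integral_const_mul, integral_add (h2.const_mul _) hi2, integral_const_mul, hv, mul_one]
  rw [← hbd]
  refine norm_integral_le_of_norm_le (((h2.const_mul _).add hi2).const_mul _)
    (.of_forall fun x => (norm_exp_sub_taylor_le (s * x)).trans ?_)
  have e : 4 * (s * x) ^ 2 * min 1 |s * x| = 4 * θ ^ 2 / k * (x ^ 2 * min 1 |s * x|) := by
    rw [mul_pow, hs2]; ring
  rw [e]
  gcongr
  split_ifs with h
  · have : x ^ 2 * min 1 |s * x| ≤ x ^ 2 * 1 := by gcongr; exact min_le_left _ _
    have : 0 ≤ |θ| * √ε * x ^ 2 := by positivity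
    linarith
  · have hx : |x| ≤ √ε * √k := by
      rw [← Real.sqrt_mul hε, ← Real.sqrt_sq_eq_abs]
      exact Real.sqrt_le_sqrt ((not_lt.1 h).trans (by gcongr))
    have : |s * x| ≤ |θ| * √ε := by
      rw [hs, abs_mul, abs_mul, abs_of_pos (by positivity : 0 < (√k)⁻¹)]
      have hk' : 0 < √k := Real.sqrt_pos.2 hk
      calc (√k)⁻¹ * |θ| * |x| ≤ (√k)⁻¹ * |θ| * (√ε * √k) := by gcongr
        _ = _ := by field_simp
    calc x ^ 2 * min 1 |s * x| ≤ x ^ 2 * (|θ| * √ε) := by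
          gcongr; exact (min_le_right _ _).trans this
      _ = _ := by ring

lemma tendsto_charFun_pow_of_lindeberg {ρ : ℕ → Measure ℝ} (hρ : ∀ n, IsProbabilityMeasure (ρ n))
    (h1 : ∀ n, Integrable (fun x => x) (ρ n)) (h2 : ∀ n, Integrable (fun x => x ^ 2) (ρ n))
    (hm : ∀ n, ∫ x, x ∂ρ n = 0) (hv : ∀ n, ∫ x, x ^ 2 ∂ρ n = 1)
    {k : ℕ → ℕ} (hk : Tendsto k atTop atTop) {L : ℕ → ℝ} (hL : ∀ᶠ n in atTop, L n ≤ k n)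
    (hLind : ∀ ε : ℝ, 0 < ε →
      Tendsto (fun n => ∫ x, (if ε * L n < x ^ 2 then x ^ 2 else 0) ∂ρ n) atTop (𝓝 0)) (θ : ℝ) :
    Tendsto (fun n => charFun (ρ n) ((√(k n : ℝ))⁻¹ * θ) ^ k n) atTop
      (𝓝 (Complex.exp (-θ ^ 2 / 2))) := by
  have hb : Tendsto (fun n => (1 + ((-θ ^ 2 / (2 * k n) : ℝ) : ℂ)) ^ k n) atTop
      (𝓝 (Complex.exp (-θ ^ 2 / 2))) := by
    have := (Complex.tendsto_one_add_pow_exp_of_tendsto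
      (g := fun j : ℕ => ((-θ ^ 2 / (2 * j) : ℝ) : ℂ)) (t := -θ ^ 2 / 2) ?_).comp hk
    · exact this
    · refine tendsto_const_nhds.congr' ?_
      filter_upwards [eventually_gt_atTop 0] with j hj
      have : (j : ℂ) ≠ 0 := by exact_mod_cast hj.ne'
      push_cast
      field_simp
  have hdiff : Tendsto (fun n => charFun (ρ n) ((√(k n : ℝ))⁻¹ * θ) ^ k n
      - (1 + ((-θ ^ 2 / (2 * k n) : ℝ) : ℂ)) ^ k n) atTop (𝓝 0) := by
    rw [NormedAddGroup.tendsto_nhds_zero]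
    intro η hη
    obtain ⟨ε, hε, hεη⟩ : ∃ ε : ℝ, 0 < ε ∧ 4 * θ ^ 2 * (|θ| * √ε) < η / 2 := by
      have : Tendsto (fun ε : ℝ => 4 * θ ^ 2 * (|θ| * √ε)) (𝓝[>] 0) (𝓝 0) := by
        have : Continuous fun ε : ℝ => 4 * θ ^ 2 * (|θ| * √ε) := by fun_prop
        simpa using (this.tendsto 0).mono_left nhdsWithin_le_nhds
      have hlt := this.eventually (gt_mem_nhds (half_pos hη))
      obtain ⟨ε, h, h'⟩ := (hlt.and self_mem_nhdsWithin).exists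
      exact ⟨ε, h', h⟩
    have hl : Tendsto (fun n => 4 * θ ^ 2 *
        ∫ x, (if ε * L n < x ^ 2 then x ^ 2 else 0) ∂ρ n) atTop (𝓝 0) := by
      simpa using (hLind ε hε).const_mul (4 * θ ^ 2)
    have hkr : Tendsto (fun n => (k n : ℝ)) atTop atTop := tendsto_natCast_atTop_atTop.comp hk
    filter_upwards [hl.eventually (gt_mem_nhds (half_pos hη)), hL,
      hkr.eventually_ge_atTop 1, hkr.eventually_ge_atTop (θ ^ 2)] with n hn hLn hk1 hkθ
    have := hρ n
    have hk0 : (0 : ℝ) < k n := by linarith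
    have hb1 : ‖(1 + ((-θ ^ 2 / (2 * k n) : ℝ) : ℂ))‖ ≤ 1 := by
      rw [← Complex.ofReal_one, ← Complex.ofReal_add, Complex.norm_real, Real.norm_eq_abs,
        abs_le]
      have h0 : 0 ≤ θ ^ 2 / (2 * k n) := by positivity
      have h1 : θ ^ 2 / (2 * k n) ≤ 1 := by rw [div_le_one (by positivity)]; linarith
      rw [neg_div]
      constructor <;> linarith
    refine (norm_pow_sub_pow_le_mul (norm_charFun_le_one _) hb1 _).trans_lt ?_
    have hmain := norm_charFun_sub_le (h1 n) (h2 n) (hm n) (hv n) hk0 θ hε.le hLn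
    have e : (1 + ((-θ ^ 2 / (2 * k n) : ℝ) : ℂ)) = ((1 - θ ^ 2 / (2 * k n) : ℝ) : ℂ) := by
      push_cast; ring
    rw [e]
    calc (k n : ℝ) * ‖_‖ ≤ k n * (4 * θ ^ 2 / k n *
          (|θ| * √ε + ∫ x, (if ε * L n < x ^ 2 then x ^ 2 else 0) ∂ρ n)) := by gcongr
      _ = 4 * θ ^ 2 * (|θ| * √ε)
          + 4 * θ ^ 2 * ∫ x, (if ε * L n < x ^ 2 then x ^ 2 else 0) ∂ρ n := by
        field_simp
      _ < η := by linarith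
  simpa using hdiff.add hb

lemma exists_pos_le_measure_of_lindeberg {Ω : ℕ → Type*} [∀ n, MeasurableSpace (Ω n)]
    {P : ∀ n, Measure (Ω n)} [∀ n, IsProbabilityMeasure (P n)] {Y : ∀ n, ℕ → Ω n → ℝ}
    (hY : ∀ n i, Measurable (Y n i)) (hind : ∀ n, iIndepFun (Y n) (P n))
    (hident : ∀ n i, IdentDistrib (Y n i) (Y n 0) (P n) (P n))
    (h2 : ∀ n, MemLp (Y n 0) 2 (P n))
    (hm : ∀ n, ∫ ω, Y n 0 ω ∂P n = 0) (hv : ∀ n, ∫ ω, Y n 0 ω ^ 2 ∂P n = 1)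
    {k : ℕ → ℕ} (hk : Tendsto k atTop atTop) {L : ℕ → ℝ} (hL : ∀ᶠ n in atTop, L n ≤ k n)
    (hLind : ∀ ε : ℝ, 0 < ε → Tendsto (fun n =>
      ∫ ω, (if ε * L n < Y n 0 ω ^ 2 then Y n 0 ω ^ 2 else 0) ∂P n) atTop (𝓝 0))
    {G : Set ℝ} (hG : IsOpen G) (hne : G.Nonempty) :
    ∃ δ : ℝ, 0 < δ ∧ ∀ᶠ n in atTop,
      δ ≤ (P n).real {ω | (√(k n : ℝ))⁻¹ * ∑ i ∈ Finset.range (k n), Y n i ω ∈ G} := by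
  have hZ : ∀ n, Measurable fun ω => (√(k n : ℝ))⁻¹ * ∑ i ∈ Finset.range (k n), Y n i ω :=
    fun n => (Finset.measurable_fun_sum _ fun i _ => hY n i).const_mul _
  have hρ : ∀ n, IsProbabilityMeasure ((P n).map (Y n 0)) := fun n =>
    Measure.isProbabilityMeasure_map (hY n 0).aemeasurable
  let Z : ℕ → ProbabilityMeasure ℝ := fun n =>
    ⟨(P n).map fun ω => (√(k n : ℝ))⁻¹ * ∑ i ∈ Finset.range (k n), Y n i ω,
      Measure.isProbabilityMeasure_map (hZ n).aemeasurable⟩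
  have hsm : ∀ a : ℝ, Measurable fun x : ℝ => if a < x ^ 2 then x ^ 2 else 0 := fun a =>
    Measurable.ite (measurableSet_lt measurable_const (by fun_prop)) (by fun_prop) (by fun_prop)
  have hlim : Tendsto Z atTop (𝓝 ⟨gaussianReal 0 1, inferInstance⟩) := by
    refine ProbabilityMeasure.tendsto_iff_tendsto_charFun.2 fun θ => ?_
    have key := tendsto_charFun_pow_of_lindeberg (ρ := fun n => (P n).map (Y n 0)) hρ
      (fun n => (integrable_map_measure (by fun_prop) (hY n 0).aemeasurable).2
        ((h2 n).integrable (by norm_num)))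
      (fun n => (integrable_map_measure (by fun_prop) (hY n 0).aemeasurable).2
        (h2 n).integrable_sq)
      (fun n => by rw [integral_map (hY n 0).aemeasurable (by fun_prop), hm])
      (fun n => by rw [integral_map (hY n 0).aemeasurable (by fun_prop), hv]) hk hL
      (fun ε hε => by
        simpa only [integral_map (hY _ 0).aemeasurable (hsm _).aestronglyMeasurable]
          using hLind ε hε) θ
    have e2 : charFun (gaussianReal 0 1) θ = Complex.exp (-θ ^ 2 / 2) := by
      rw [charFun_gaussianReal]; simp [neg_div]
    simpa [Z, charFun_inv_sqrt_mul_sum (hind _) (hident _), e2] using key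
  have hpos : 0 < gaussianReal 0 1 G := by
    rw [pos_iff_ne_zero]
    intro h0
    exact (hG.measure_pos volume hne).ne'
      (gaussianReal_absolutelyContinuous' 0 one_ne_zero h0)
  have hlow := ProbabilityMeasure.le_liminf_measure_open_of_tendsto hlim hG
  obtain ⟨δ, hδ0, hδ⟩ := exists_between (hpos.trans_le hlow)
  have hδtop : δ ≠ ∞ := by
    intro h; rw [h] at hδ; exact not_top_lt hδ
  refine ⟨δ.toReal, ENNReal.toReal_pos hδ0.ne' hδtop, ?_⟩
  filter_upwards [eventually_lt_of_lt_liminf hδ] with n hn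
  have hn' : δ < (P n) {ω | (√(k n : ℝ))⁻¹ * ∑ i ∈ Finset.range (k n), Y n i ω ∈ G} := by
    have : (Z n : Measure ℝ) G = _ := Measure.map_apply (hZ n) hG.measurableSet
    rw [this] at hn
    exact hn
  exact ENNReal.toReal_mono (measure_ne_top _ _) hn'.le

end Lindeberg

section LogSums

open ProbabilityTheory Topology

/-- `q` is a probability distribution on the positive integers under which the logarithm has
mean `μ` and variance `s ^ 2`. -/
structure HasLogMoments (q : ℕ → ℝ) (μ s : ℝ) : Prop where
  nonneg : ∀ k, 0 ≤ q k
  zero : q 0 = 0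
  tsum_one : ∑' k, q k = 1
  mean_pos : 0 < μ
  dev_pos : 0 < s
  summable_log : Summable fun k : ℕ => q k * Real.log k
  mean : μ = ∑' k : ℕ, q k * Real.log k
  summable_sq : Summable fun k : ℕ => q k * (Real.log k - μ) ^ 2
  var : s ^ 2 = ∑' k : ℕ, q k * (Real.log k - μ) ^ 2

/-- A probability space carrying independent pile numbers with distribution `q`. -/
structure PileSpace (q : ℕ → ℝ) where
  Ω : Type
  [mΩ : MeasurableSpace Ω]
  P : Measure Ω
  [isProb : IsProbabilityMeasure P]
  X : ℕ → Ω → ℕ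
  meas : ∀ i, Measurable (X i)
  law : ∀ i, HasLaw (X i) (massLaw q) P
  indep : iIndepFun X P

attribute [instance] PileSpace.mΩ PileSpace.isProb

namespace HasLogMoments

variable {q : ℕ → ℝ} {μ s : ℝ}

lemma nonempty_pileSpace (h : HasLogMoments q μ s) : Nonempty (PileSpace q) := by
  have := isProbabilityMeasure_massLaw h.nonneg h.tsum_one
  obtain ⟨Ω, m, P, X, h1, h2, h3, h4⟩ := exists_iid ℕ (massLaw q)
  exact ⟨⟨Ω, P, X, h1, h2, h3⟩⟩

end HasLogMoments

namespace PileSpace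

variable {q : ℕ → ℝ} (D : PileSpace q)

/-- The number of piles of the composition of the first `k` shuffles. -/
def piles (k : ℕ) : D.Ω → ℕ := ∏ i ∈ Finset.range k, D.X i

/-- The standardized logarithm of the `i`-th pile number. -/
def Y (μ s : ℝ) (i : ℕ) (ω : D.Ω) : ℝ := (Real.log (D.X i ω) - μ) / s

lemma measurable_piles (k : ℕ) : Measurable (D.piles k) := by
  unfold piles
  simpa only [← Finset.prod_apply] using!
    Finset.measurable_prod (Finset.range k) fun i _ => D.meas i

lemma measurable_Y (μ s : ℝ) (i : ℕ) : Measurable (D.Y μ s i) :=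
  (measurable_from_nat (f := fun m : ℕ => (Real.log m - μ) / s)).comp (D.meas i)

lemma indep_Y (μ s : ℝ) : iIndepFun (D.Y μ s) D.P :=
  D.indep.comp (fun _ m => (Real.log m - μ) / s) fun _ => measurable_from_nat

lemma identDistrib_Y (μ s : ℝ) (i j : ℕ) : IdentDistrib (D.Y μ s i) (D.Y μ s j) D.P D.P := by
  have : IdentDistrib (D.X i) (D.X j) D.P D.P :=
    ⟨(D.meas i).aemeasurable, (D.meas j).aemeasurable, by rw [(D.law i).map_eq, (D.law j).map_eq]⟩
  exact this.comp (u := fun m : ℕ => (Real.log m - μ) / s) measurable_from_nat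

variable {D} {μ s : ℝ}

lemma integral_comp_X (h : HasLogMoments q μ s) (g : ℕ → ℝ) (i : ℕ) :
    ∫ ω, g (D.X i ω) ∂D.P = ∑' k, q k * g k := by
  rw [← integral_massLaw h.nonneg]
  exact (D.law i).integral_comp measurable_from_nat.aestronglyMeasurable

lemma integrable_comp_X (h : HasLogMoments q μ s) {g : ℕ → ℝ}
    (hg : Summable fun k => q k * |g k|) (i : ℕ) : Integrable (fun ω => g (D.X i ω)) D.P := by
  have : Integrable g (D.P.map (D.X i)) := by
    rw [(D.law i).map_eq]; exact (integrable_massLaw h.nonneg).2 hg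
  exact this.comp_measurable (D.meas i)

lemma integrable_log_X (h : HasLogMoments q μ s) (i : ℕ) :
    Integrable (fun ω => Real.log (D.X i ω)) D.P := by
  refine integrable_comp_X h (g := fun m => Real.log m) ?_ i
  simpa only [abs_of_nonneg (Real.log_natCast_nonneg _)] using h.summable_log

lemma memLp_Y (h : HasLogMoments q μ s) (i : ℕ) : MemLp (D.Y μ s i) 2 D.P := by
  rw [memLp_two_iff_integrable_sq (D.measurable_Y μ s i).aestronglyMeasurable]
  refine integrable_comp_X h (g := fun m : ℕ => ((Real.log m - μ) / s) ^ 2) ?_ i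
  simp_rw [abs_sq, div_pow, ← mul_div_assoc]
  exact h.summable_sq.div_const _

lemma integral_Y (h : HasLogMoments q μ s) (i : ℕ) : ∫ ω, D.Y μ s i ω ∂D.P = 0 := by
  have := integral_comp_X (D := D) h (fun m => Real.log m) i
  rw [← h.mean] at this
  unfold Y
  rw [integral_div, integral_sub (integrable_log_X h i) (integrable_const _), this]
  simp

lemma integral_Y_sq (h : HasLogMoments q μ s) (i : ℕ) : ∫ ω, D.Y μ s i ω ^ 2 ∂D.P = 1 := by
  rw [show ∫ ω, D.Y μ s i ω ^ 2 ∂D.P = _ from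
    integral_comp_X h (fun m : ℕ => ((Real.log m - μ) / s) ^ 2) i]
  simp_rw [div_pow, ← mul_div_assoc]
  rw [tsum_div_const, ← h.var, div_self (pow_pos h.dev_pos 2).ne']

lemma ae_one_le_X (h : HasLogMoments q μ s) : ∀ᵐ ω ∂D.P, ∀ i, 1 ≤ D.X i ω := by
  rw [ae_all_iff]
  intro i
  exact ((D.law i).ae_iff (p := fun m => 1 ≤ m) (by fun_prop)).2 (ae_one_le_massLaw h.zero)

lemma ae_one_le_piles (h : HasLogMoments q μ s) (k : ℕ) : ∀ᵐ ω ∂D.P, 1 ≤ D.piles k ω := by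
  filter_upwards [ae_one_le_X h] with ω hω
  rw [piles, Finset.prod_apply]
  exact Finset.one_le_prod' fun i _ => hω i

lemma ae_log_piles (h : HasLogMoments q μ s) (k : ℕ) :
    ∀ᵐ ω ∂D.P, Real.log (D.piles k ω) = k * μ + s * ∑ i ∈ Finset.range k, D.Y μ s i ω := by
  filter_upwards [ae_one_le_X h] with ω hω
  rw [piles, Finset.prod_apply, Nat.cast_prod,
    Real.log_prod fun i _ => by exact_mod_cast (Nat.one_le_iff_ne_zero.1 (hω i)), Finset.mul_sum]
  have : ∀ i, s * D.Y μ s i ω = Real.log (D.X i ω) - μ := fun i => by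
    rw [Y, mul_div_cancel₀ _ h.dev_pos.ne']
  simp [this]

lemma measureReal_le_abs_sum_Y (h : HasLogMoments q μ s) (k : ℕ) {a : ℝ} (ha : 0 < a) :
    D.P.real {ω | a ≤ |s * ∑ i ∈ Finset.range k, D.Y μ s i ω|} ≤ k * s ^ 2 / a ^ 2 := by
  have hL : MemLp (fun ω => ∑ i ∈ Finset.range k, D.Y μ s i ω) 2 D.P :=
    memLp_finsetSum _ fun i _ => memLp_Y h i
  have hvar : Var[fun ω => ∑ i ∈ Finset.range k, D.Y μ s i ω; D.P] = k := by
    rw [← Finset.sum_fn, IndepFun.variance_sum (fun i _ => memLp_Y h i)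
      fun i _ j _ hij => (D.indep_Y μ s).indepFun hij]
    rw [Finset.sum_congr rfl (g := fun _ => (1 : ℝ))]
    · simp
    · intro i _
      rw [variance_of_integral_eq_zero (D.measurable_Y μ s i).aemeasurable (integral_Y h i),
        integral_Y_sq h]
  have hmean : ∫ ω, ∑ i ∈ Finset.range k, D.Y μ s i ω ∂D.P = 0 := by
    rw [integral_finsetSum _ fun i _ => (memLp_Y h i).integrable (by norm_num)]
    simp [integral_Y h]
  have hs := h.dev_pos
  have key := meas_ge_le_variance_div_sq hL (div_pos ha hs)
  rw [hvar, hmean] at key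
  have key2 := ENNReal.toReal_mono ENNReal.ofReal_ne_top key
  rw [ENNReal.toReal_ofReal (by positivity)] at key2
  have e : (k : ℝ) / (a / s) ^ 2 = k * s ^ 2 / a ^ 2 := by field_simp
  rw [e] at key2
  refine le_trans (le_of_eq ?_) key2
  rw [measureReal_def]
  congr 2
  ext ω
  simp only [Set.mem_ofPred_eq, sub_zero, abs_mul, abs_of_pos hs]
  rw [div_le_iff₀ hs, mul_comm]

lemma iterConv_Qp {n : ℕ} (hn : 1 ≤ n) (D : PileSpace q) (h : HasLogMoments q μ s) (k : ℕ) :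
    iterConv n (Qp n q) k = mixQs n D.P (D.piles k) :=
  iterConv_Qp_eq_mixQs hn h.nonneg D.meas D.law D.indep k

end PileSpace

namespace HasLogMoments

variable {q : ℕ → ℝ} {μ s : ℝ}

lemma tv_iterConv_le_one {n : ℕ} (hn : 1 ≤ n) (h : HasLogMoments q μ s) (k : ℕ) :
    tv n (iterConv n (Qp n q) k) (Us n) ≤ 1 := by
  obtain ⟨D⟩ := h.nonempty_pileSpace
  rw [D.iterConv_Qp hn h]
  exact tv_mixQs_le_one hn (D.measurable_piles k) (PileSpace.ae_one_le_piles h k)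

end HasLogMoments

namespace PileSpace

variable {q : ℕ → ℝ} {μ s : ℝ} {D : PileSpace q}

lemma tv_iterConv_le {n : ℕ} (hn : 1 ≤ n) (h : HasLogMoments q μ s) (k : ℕ) {y δ η : ℝ}
    (hδ : 0 ≤ δ)
    (hM : ∀ m : ℕ, 1 ≤ m → Real.exp y ≤ m → tv n (Qs n m) (Us n) ≤ 1 - δ)
    (hη : η ≤ D.P.real {ω | y ≤ k * μ + s * ∑ i ∈ Finset.range k, D.Y μ s i ω}) :
    tv n (iterConv n (Qp n q) k) (Us n) ≤ 1 - δ * η := by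
  rw [D.iterConv_Qp hn h]
  refine (tv_mixQs_le hn (D.measurable_piles k) (ae_one_le_piles h k)
    (M := ⌈Real.exp y⌉₊) fun m hm hMm => hM m hm (Nat.ceil_le.1 hMm)).trans ?_
  have : D.P.real {ω | y ≤ k * μ + s * ∑ i ∈ Finset.range k, D.Y μ s i ω}
      ≤ D.P.real {ω | ⌈Real.exp y⌉₊ ≤ D.piles k ω} := by
    refine ENNReal.toReal_mono (measure_ne_top _ _) (measure_mono_ae ?_)
    filter_upwards [ae_log_piles h k, ae_one_le_piles h k] with ω h1 h2 h3
    have h3 : y ≤ k * μ + s * ∑ i ∈ Finset.range k, D.Y μ s i ω := h3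
    rw [← h1, Real.le_log_iff_exp_le (by exact_mod_cast h2)] at h3
    exact Nat.ceil_le.2 h3
  have := hη.trans this
  gcongr

lemma le_tv_iterConv {n : ℕ} (hn : 1 ≤ n) (h : HasLogMoments q μ s) (k : ℕ) {y δ η : ℝ}
    (hδ : 0 ≤ δ) (hy : 0 ≤ y) (hM : δ ≤ tv n (Qs n ⌊Real.exp y⌋₊) (Us n))
    (hη : η ≤ D.P.real {ω | k * μ + s * ∑ i ∈ Finset.range k, D.Y μ s i ω ≤ y}) :
    η * δ ≤ tv n (iterConv n (Qp n q) k) (Us n) := by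
  rw [D.iterConv_Qp hn h]
  refine le_trans ?_ (le_tv_mixQs hn (D.measurable_piles k) (ae_one_le_piles h k)
    (M := ⌊Real.exp y⌋₊) (Nat.le_floor (by simpa using hy)))
  have : D.P.real {ω | k * μ + s * ∑ i ∈ Finset.range k, D.Y μ s i ω ≤ y}
      ≤ D.P.real {ω | D.piles k ω ≤ ⌊Real.exp y⌋₊} := by
    refine ENNReal.toReal_mono (measure_ne_top _ _) (measure_mono_ae ?_)
    filter_upwards [ae_log_piles h k, ae_one_le_piles h k] with ω h1 h2 h3
    have h3 : k * μ + s * ∑ i ∈ Finset.range k, D.Y μ s i ω ≤ y := h3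
    rw [← h1, Real.log_le_iff_le_exp (by exact_mod_cast h2)] at h3
    exact Nat.le_floor h3
  have := hη.trans this
  gcongr

end PileSpace

namespace HasLogMoments

variable {q : ℕ → ℝ} {μ s : ℝ}

lemma tv_iterConv_le_chebyshev {n : ℕ} (hn : 1 ≤ n) (h : HasLogMoments q μ s) {k : ℕ}
    {a y δ : ℝ} (ha : 0 < a) (hy : y ≤ k * μ - a) (hδ0 : 0 ≤ δ)
    (hM : ∀ m : ℕ, 1 ≤ m → Real.exp y ≤ m → tv n (Qs n m) (Us n) ≤ δ) :
    tv n (iterConv n (Qp n q) k) (Us n) ≤ k * s ^ 2 / a ^ 2 + δ := by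
  obtain ⟨D⟩ := h.nonempty_pileSpace
  have hr : 0 ≤ k * s ^ 2 / a ^ 2 := by positivity
  rcases le_total 1 δ with h1 | h1
  · linarith [h.tv_iterConv_le_one hn k]
  · have hsub : {ω | a ≤ |s * ∑ i ∈ Finset.range k, D.Y μ s i ω|}ᶜ
        ⊆ {ω | y ≤ k * μ + s * ∑ i ∈ Finset.range k, D.Y μ s i ω} := by
      intro ω hω
      simp only [Set.mem_compl_iff, Set.mem_ofPred_eq, not_le] at hω ⊢
      linarith [(abs_lt.1 hω).1]
    have hmeas : MeasurableSet {ω | a ≤ |s * ∑ i ∈ Finset.range k, D.Y μ s i ω|} := by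
      have : Measurable fun ω => ∑ i ∈ Finset.range k, D.Y μ s i ω :=
        Finset.measurable_fun_sum _ fun i _ => D.measurable_Y μ s i
      exact measurableSet_le measurable_const (by fun_prop)
    have hη : 1 - k * s ^ 2 / a ^ 2
        ≤ D.P.real {ω | y ≤ k * μ + s * ∑ i ∈ Finset.range k, D.Y μ s i ω} := by
      refine le_trans ?_ (measureReal_mono hsub)
      rw [probReal_compl_eq_one_sub hmeas]
      linarith [D.measureReal_le_abs_sum_Y h k ha]
    have := PileSpace.tv_iterConv_le hn h k (δ := 1 - δ) (by linarith)
      (fun m hm hym => by linarith [hM m hm hym]) hη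
    nlinarith

lemma le_tv_iterConv_chebyshev {n : ℕ} (hn : 1 ≤ n) (h : HasLogMoments q μ s) {k : ℕ}
    {a y δ : ℝ} (ha : 0 < a) (hy : k * μ + a ≤ y) (hy0 : 0 ≤ y) (hδ0 : 0 ≤ δ)
    (hM : δ ≤ tv n (Qs n ⌊Real.exp y⌋₊) (Us n)) :
    (1 - k * s ^ 2 / a ^ 2) * δ ≤ tv n (iterConv n (Qp n q) k) (Us n) := by
  obtain ⟨D⟩ := h.nonempty_pileSpace
  rcases le_total (1 - k * s ^ 2 / a ^ 2) 0 with h1 | h1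
  · exact (mul_nonpos_of_nonpos_of_nonneg h1 hδ0).trans (tv_nonneg _ _ _)
  · have hsub : {ω | a ≤ |s * ∑ i ∈ Finset.range k, D.Y μ s i ω|}ᶜ
        ⊆ {ω | k * μ + s * ∑ i ∈ Finset.range k, D.Y μ s i ω ≤ y} := by
      intro ω hω
      simp only [Set.mem_compl_iff, Set.mem_ofPred_eq, not_le] at hω ⊢
      linarith [(abs_lt.1 hω).2]
    have hmeas : MeasurableSet {ω | a ≤ |s * ∑ i ∈ Finset.range k, D.Y μ s i ω|} := by
      have : Measurable fun ω => ∑ i ∈ Finset.range k, D.Y μ s i ω :=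
        Finset.measurable_fun_sum _ fun i _ => D.measurable_Y μ s i
      exact measurableSet_le measurable_const (by fun_prop)
    refine PileSpace.le_tv_iterConv (D := D) hn h k hδ0 hy0 hM ?_
    refine le_trans ?_ (measureReal_mono hsub)
    rw [probReal_compl_eq_one_sub hmeas]
    linarith [D.measureReal_le_abs_sum_Y h k ha]

end HasLogMoments

end LogSums

section Thresholds

lemma exp_sq_threshold {n : ℕ} (hn : 1 ≤ n) (a : ℝ) :
    Real.exp (3 / 2 * Real.log n + a) ^ 2 = (n : ℝ) ^ 3 * Real.exp (2 * a) := by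
  have hn0 : (0 : ℝ) < n := by exact_mod_cast hn
  rw [← Real.exp_nat_mul, show ((2 : ℕ) : ℝ) * (3 / 2 * Real.log n + a)
    = ((3 : ℕ) : ℝ) * Real.log n + 2 * a by push_cast; ring, Real.exp_add, Real.exp_nat_mul,
    Real.exp_log hn0]

lemma exp_neg_mul_exp_two (a : ℝ) : Real.exp (-2 * a) * Real.exp (2 * a) = 1 := by
  rw [← Real.exp_add]; simp

lemma threshold_le_card {n m : ℕ} (hn : 1 ≤ n) {a : ℝ} (ha : 64 * Real.exp (-2 * a) ≤ n)
    (hm : Real.exp (3 / 2 * Real.log n + a) ≤ m) :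
    8 * n ≤ m ∧ Real.exp (8 * (n : ℝ) ^ 3 / (m : ℝ) ^ 2) ≤ Real.exp (8 * Real.exp (-2 * a)) := by
  have hn0 : (0 : ℝ) < n := by exact_mod_cast hn
  have hm0 : (0 : ℝ) < m := (Real.exp_pos _).trans_le hm
  have hsq : (n : ℝ) ^ 3 * Real.exp (2 * a) ≤ (m : ℝ) ^ 2 := by
    rw [← exp_sq_threshold hn]
    gcongr
  have hinv := exp_neg_mul_exp_two a
  have hE := Real.exp_pos (2 * a)
  have hF := Real.exp_pos (-2 * a)
  constructor
  · have h1 : 64 ≤ n * Real.exp (2 * a) := by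
      calc (64 : ℝ) = 64 * Real.exp (-2 * a) * Real.exp (2 * a) := by rw [mul_assoc, hinv, mul_one]
        _ ≤ _ := by gcongr
    have h2 : (8 * (n : ℝ)) ^ 2 ≤ (m : ℝ) ^ 2 := by
      calc (8 * (n : ℝ)) ^ 2 = n ^ 2 * 64 := by ring
        _ ≤ n ^ 2 * (n * Real.exp (2 * a)) := by gcongr
        _ = n ^ 3 * Real.exp (2 * a) := by ring
        _ ≤ _ := hsq
    have := abs_le_of_sq_le_sq' h2 hm0.le
    exact_mod_cast this.2
  · rw [Real.exp_le_exp, div_le_iff₀ (by positivity)]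
    calc 8 * (n : ℝ) ^ 3 = 8 * Real.exp (-2 * a) * (n ^ 3 * Real.exp (2 * a)) := by
          linear_combination -8 * (n : ℝ) ^ 3 * hinv
      _ ≤ _ := by gcongr

lemma le_tv_Qs_threshold {n : ℕ} (hn : 2 ≤ n) {a : ℝ} (ha : Real.exp (-2 * a) ≤ n)
    (hy : 0 ≤ 3 / 2 * Real.log n + a) :
    1 - (√(1 + Real.exp (-2 * a) / 192))⁻¹
      ≤ tv n (Qs n ⌊Real.exp (3 / 2 * Real.log n + a)⌋₊) (Us n) := by
  set E := Real.exp (3 / 2 * Real.log n + a) with hE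
  have hn2 : (2 : ℝ) ≤ n := by exact_mod_cast hn
  have hE1 : 1 ≤ E := Real.one_le_exp hy
  have hsq : E ^ 2 = (n : ℝ) ^ 3 * Real.exp (2 * a) := exp_sq_threshold (by omega) a
  have hM1 : 1 ≤ ⌊E⌋₊ := Nat.le_floor (by simpa using hE1)
  have hME : (⌊E⌋₊ : ℝ) ≤ E := Nat.floor_le (by linarith)
  set M := ⌊E⌋₊
  have hM0 : (1 : ℝ) ≤ M := by exact_mod_cast hM1
  have hinv := exp_neg_mul_exp_two a
  have hF0 := Real.exp_pos (2 * a)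
  have hF := Real.exp_pos (-2 * a)
  have hnE : (n : ℝ) ≤ E := by
    refine (abs_le_of_sq_le_sq' ?_ (by linarith)).2
    rw [hsq]
    have h1 : 1 ≤ n * Real.exp (2 * a) := by
      rw [← hinv]; gcongr
    calc (n : ℝ) ^ 2 = n ^ 2 * 1 := by ring
      _ ≤ n ^ 2 * (n * Real.exp (2 * a)) := by gcongr
      _ = _ := by ring
  refine tv_Qs_ge (by omega) hM1 (by positivity) ?_
  rw [le_div_iff₀ (by positivity)]
  have h1 : (M : ℝ) * (M + n) ≤ 2 * ((n : ℝ) ^ 3 * Real.exp (2 * a)) := by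
    calc (M : ℝ) * (M + n) ≤ E * (E + E) := by gcongr
      _ = _ := by rw [← hsq]; ring
  calc Real.exp (-2 * a) / 192 * (48 * M * (M + n))
      = Real.exp (-2 * a) / 4 * (M * (M + n)) := by ring
    _ ≤ Real.exp (-2 * a) / 4 * (2 * ((n : ℝ) ^ 3 * Real.exp (2 * a))) := by gcongr
    _ = (n : ℝ) ^ 3 / 2 := by linear_combination (n : ℝ) ^ 3 / 2 * hinv
    _ ≤ (n : ℝ) ^ 3 - n := by nlinarith [mul_self_nonneg ((n : ℝ) - 2)]

end Thresholds

lemma HasLogMoments.one_le_truncated {q : ℕ → ℝ} {μ s : ℝ} (h : HasLogMoments q μ s)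
    {T A B : ℝ} (hpos : ∀ k : ℕ, 0 ≤ A * ((Real.log k - μ) / s) + B)
    (hle : ∀ k : ℕ, ((Real.log k - μ) / s) ^ 2 ≤ T →
      ((Real.log k - μ) / s) ^ 2 ≤ A * ((Real.log k - μ) / s) + B) :
    1 ≤ (∑' k : ℕ, q k * (if T < ((Real.log k - μ) / s) ^ 2 then
      ((Real.log k - μ) / s) ^ 2 else 0)) + B := by
  have hs := h.dev_pos
  have hq : HasSum q 1 := by
    have hsum : Summable q := by
      by_contra hq
      simpa [tsum_eq_zero_of_not_summable hq] using h.tsum_one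
    simpa [h.tsum_one] using hsum.hasSum
  have hmean : HasSum (fun k : ℕ => q k * ((Real.log k - μ) / s)) 0 := by
    have h1 : HasSum (fun k : ℕ => q k * Real.log k) μ := by
      simpa [← h.mean] using h.summable_log.hasSum
    have h2 := (h1.sub (hq.mul_right μ)).div_const s
    rw [one_mul, sub_self, zero_div] at h2
    simpa only [← mul_sub, mul_div_assoc] using h2
  have hsq : HasSum (fun k : ℕ => q k * ((Real.log k - μ) / s) ^ 2) 1 := by
    have h1 := h.summable_sq.hasSum
    rw [← h.var] at h1
    have h2 := h1.div_const (s ^ 2)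
    rw [div_self (by positivity)] at h2
    simpa only [mul_div_assoc, ← div_pow] using h2
  have htr : Summable fun k : ℕ => q k * (if T < ((Real.log k - μ) / s) ^ 2 then
      ((Real.log k - μ) / s) ^ 2 else 0) := by
    refine hsq.summable.of_nonneg_of_le (fun k => ?_) fun k => ?_
    · have := h.nonneg k
      split_ifs <;> positivity
    · have := h.nonneg k
      gcongr
      split_ifs
      · exact le_rfl
      · positivity
  have hsum := htr.hasSum.add ((hmean.mul_left A).add (hq.mul_left B))
  have := hasSum_le (fun k => ?_) hsq hsum
  · simpa using this
  · have hk := h.nonneg k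
    have key : ((Real.log k - μ) / s) ^ 2 ≤ (if T < ((Real.log k - μ) / s) ^ 2 then
      ((Real.log k - μ) / s) ^ 2 else 0) + (A * ((Real.log k - μ) / s) + B) := by
      split_ifs with hT
      · linarith [hpos k]
      · linarith [hle k (not_lt.1 hT)]
    calc _ ≤ q k * ((if T < ((Real.log k - μ) / s) ^ 2 then
      ((Real.log k - μ) / s) ^ 2 else 0) + (A * ((Real.log k - μ) / s) + B)) := by gcongr
      _ = _ := by ring

/-- A sequence of pile distributions with log-moments `μ n`, `s n` satisfying the Lindeberg
condition at scale `log n / μ n`. -/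
structure LindebergShuffles (p : ℕ → ℕ → ℝ) (μ s : ℕ → ℝ) : Prop where
  moments : ∀ n, HasLogMoments (p n) (μ n) (s n)
  lindeberg : ∀ ε : ℝ, 0 < ε → Tendsto (fun n : ℕ => ∑' k : ℕ, p n k *
    (if ε * (Real.log n / μ n) < ((Real.log k - μ n) / s n) ^ 2 then
      ((Real.log k - μ n) / s n) ^ 2 else 0)) atTop (nhds 0)

/-- The cutoff window on the logarithmic scale. -/
def logWindow (μ s : ℕ → ℝ) (n : ℕ) : ℝ := max 1 (s n * √(Real.log n / μ n))

lemma one_le_logWindow (μ s : ℕ → ℝ) (n : ℕ) : 1 ≤ logWindow μ s n := le_max_left _ _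

lemma logWindow_pos (μ s : ℕ → ℝ) (n : ℕ) : 0 < logWindow μ s n :=
  zero_lt_one.trans_le (one_le_logWindow μ s n)

namespace LindebergShuffles

variable {p : ℕ → ℕ → ℝ} {μ s : ℕ → ℝ}

lemma tendsto_log_div_mean (h : LindebergShuffles p μ s) :
    Tendsto (fun n : ℕ => Real.log n / μ n) atTop atTop := by
  refine tendsto_atTop.2 fun C => ?_
  set C' := max C 1
  have hC' : 0 < C' := zero_lt_one.trans_le (le_max_right _ _)
  filter_upwards [(h.lindeberg (1 / (2 * C')) (by positivity)).eventually_lt_const one_half_pos]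
    with n hn
  have h1 := (h.moments n).one_le_truncated (T := 1 / (2 * C') * (Real.log n / μ n))
    (A := 0) (B := max (1 / (2 * C') * (Real.log n / μ n)) 0) (fun k => by simp)
    fun k hk => by simpa using Or.inl hk
  have h2 : 1 / 2 < max (1 / (2 * C') * (Real.log n / μ n)) 0 := by linarith
  have h3 := (lt_max_iff.1 h2).resolve_right (by norm_num)
  have h4 : C' < Real.log n / μ n := by
    rw [div_mul_eq_mul_div, one_mul, lt_div_iff₀ (by positivity)] at h3
    linarith
  exact (le_max_left _ _).trans h4.le

lemma eventually_dev_le (h : LindebergShuffles p μ s) {η : ℝ} (hη : 0 < η) :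
    ∀ᶠ n : ℕ in atTop, s n ≤ η * (μ n * √(Real.log n / μ n)) := by
  filter_upwards [(h.lindeberg ((η / 4) ^ 2) (by positivity)).eventually_lt_const one_half_pos]
    with n hn
  have hm := (h.moments n).mean_pos
  have hs := (h.moments n).dev_pos
  set r := √(Real.log n / μ n)
  have hL : √((η / 4) ^ 2 * (Real.log n / μ n)) = η / 4 * r := by
    rw [Real.sqrt_mul (by positivity), Real.sqrt_sq (by positivity)]
  have hr : 0 ≤ r := Real.sqrt_nonneg _
  have hlow : ∀ k : ℕ, 0 ≤ (Real.log k - μ n) / s n + μ n / s n := fun k => by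
    rw [← add_div, sub_add_cancel]
    exact div_nonneg (Real.log_natCast_nonneg k) hs.le
  have h0 : 0 ≤ μ n / s n := by positivity
  have h1 := (h.moments n).one_le_truncated (T := (η / 4) ^ 2 * (Real.log n / μ n))
    (A := η / 4 * r) (B := η / 4 * r * (2 * (μ n / s n))) (fun k => by
      rw [← mul_add]
      exact mul_nonneg (by positivity) (by linarith [hlow k])) fun k hk => by
      have habs := Real.abs_le_sqrt hk
      rw [hL] at habs
      rw [← sq_abs, ← mul_add, sq]
      refine mul_le_mul habs ?_ (abs_nonneg _) (by positivity)
      exact abs_le.2 ⟨by linarith [hlow k], by linarith⟩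
  have h2 : 1 / 2 ≤ η / 4 * r * (2 * (μ n / s n)) := by linarith
  have h3 : η / 4 * r * (2 * (μ n / s n)) = η * (μ n * r) / 2 / s n := by ring
  rw [h3, le_div_iff₀ hs] at h2
  linarith

lemma eventually_logWindow_le (h : LindebergShuffles p μ s) {η : ℝ} (hη : 0 < η) :
    ∀ᶠ n : ℕ in atTop, logWindow μ s n ≤ η * Real.log n := by
  have hlog : Tendsto (fun n : ℕ => η * Real.log n) atTop atTop :=
    (Real.tendsto_log_atTop.comp tendsto_natCast_atTop_atTop).const_mul_atTop hη
  filter_upwards [h.eventually_dev_le hη, hlog.eventually_ge_atTop 1,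
    h.tendsto_log_div_mean.eventually_ge_atTop 0] with n hn h1 hL
  refine max_le h1 ?_
  have hm := (h.moments n).mean_pos
  calc s n * √(Real.log n / μ n)
      ≤ η * (μ n * √(Real.log n / μ n)) * √(Real.log n / μ n) := by gcongr
    _ = η * (μ n * (√(Real.log n / μ n) * √(Real.log n / μ n))) := by ring
    _ = η * Real.log n := by rw [Real.mul_self_sqrt hL]; field_simp

lemma eventually_window_add_one_le (h : LindebergShuffles p μ s) (C : ℝ) :
    ∀ᶠ n : ℕ in atTop, C * (logWindow μ s n / μ n) + 1 ≤ Real.log n / μ n / 2 := by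
  set C' := max C 1
  have hC' : 0 < C' := zero_lt_one.trans_le (le_max_right _ _)
  filter_upwards [h.eventually_logWindow_le (η := 1 / (4 * C')) (by positivity),
    h.tendsto_log_div_mean.eventually_ge_atTop 4] with n hn hL
  have hm := (h.moments n).mean_pos
  have hw := logWindow_pos μ s n
  have : C * (logWindow μ s n / μ n) ≤ Real.log n / μ n / 4 := by
    calc C * (logWindow μ s n / μ n) ≤ C' * (1 / (4 * C') * Real.log n / μ n) := by
          gcongr
          exact le_max_left _ _
      _ = _ := by field_simp
  linarith

end LindebergShuffles

lemma le_toNat_ceil (x : ℝ) : x ≤ (⌈x⌉.toNat : ℝ) := by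
  rw [Int.ceil_toNat]; exact Nat.le_ceil x

lemma toNat_ceil_le {x : ℝ} (hx : 0 ≤ x) : (⌈x⌉.toNat : ℝ) ≤ x + 1 := by
  rw [Int.ceil_toNat]; exact (Nat.ceil_lt_add_one hx).le

lemma toNat_floor_le {x : ℝ} (hx : 0 ≤ x) : (⌊x⌋.toNat : ℝ) ≤ x := by
  rw [Int.floor_toNat]; exact Nat.floor_le hx

lemma sub_one_le_toNat_floor (x : ℝ) : x - 1 ≤ (⌊x⌋.toNat : ℝ) := by
  rw [Int.floor_toNat]; exact (Nat.sub_one_lt_floor x).le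

lemma one_sub_inv_sqrt_pos {x : ℝ} (hx : 0 < x) : 0 < 1 - (√(1 + x))⁻¹ := by
  have : 1 < √(1 + x) := by rw [Real.lt_sqrt (by norm_num)]; linarith
  linarith [inv_lt_one_of_one_lt₀ this]

namespace LindebergShuffles

variable {p : ℕ → ℕ → ℝ} {μ s : ℕ → ℝ}

lemma dev_sq_mul_le {n : ℕ} (hs : 0 < s n) (hL : 0 ≤ Real.log n / μ n) :
    s n ^ 2 * (Real.log n / μ n) ≤ logWindow μ s n ^ 2 := by
  calc s n ^ 2 * (Real.log n / μ n) = (s n * √(Real.log n / μ n)) ^ 2 := by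
        rw [mul_pow, Real.sq_sqrt hL]
    _ ≤ _ := by
        gcongr
        exact le_max_right _ _

lemma mul_dev_sq_div_le {n k : ℕ} {c : ℝ} (hc : 0 < c) (hs : 0 < s n)
    (hL : 0 ≤ Real.log n / μ n) (hk : (k : ℝ) ≤ 3 * (Real.log n / μ n)) :
    k * s n ^ 2 / (c * logWindow μ s n / 2) ^ 2 ≤ 12 / c ^ 2 := by
  have hw := logWindow_pos μ s n
  rw [div_le_div_iff₀ (by positivity) (by positivity)]
  have h1 := dev_sq_mul_le hs hL
  have h2 : k * s n ^ 2 ≤ 3 * logWindow μ s n ^ 2 := by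
    calc k * s n ^ 2 ≤ 3 * (Real.log n / μ n) * s n ^ 2 := by gcongr
      _ ≤ _ := by linarith
  calc k * s n ^ 2 * c ^ 2 ≤ 3 * logWindow μ s n ^ 2 * c ^ 2 := by gcongr
    _ = _ := by ring

/-- The number of shuffles located `c` windows after the cutoff time. -/
def stepsAfter (μ s : ℕ → ℝ) (c : ℝ) (n : ℕ) : ℕ :=
  ⌈3 / 2 * (Real.log n / μ n) + c * (logWindow μ s n / μ n)⌉.toNat

/-- The number of shuffles located `c` windows before the cutoff time. -/
def stepsBefore (μ s : ℕ → ℝ) (c : ℝ) (n : ℕ) : ℕ :=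
  ⌊3 / 2 * (Real.log n / μ n) - c * (logWindow μ s n / μ n)⌋.toNat

lemma le_stepsAfter_mul {n : ℕ} (hm : 0 < μ n) (c : ℝ) :
    3 / 2 * Real.log n + c * logWindow μ s n ≤ stepsAfter μ s c n * μ n := by
  calc _ = (3 / 2 * (Real.log n / μ n) + c * (logWindow μ s n / μ n)) * μ n := by field_simp
    _ ≤ _ := by
      gcongr
      exact le_toNat_ceil _

lemma stepsAfter_mul_le {n : ℕ} (hm : 0 < μ n) {c : ℝ} (hc : 0 ≤ c) :
    stepsAfter μ s c n * μ n ≤ 3 / 2 * Real.log n + c * logWindow μ s n + μ n := by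
  have hw := logWindow_pos μ s n
  have hl := Real.log_natCast_nonneg n
  calc _ ≤ (3 / 2 * (Real.log n / μ n) + c * (logWindow μ s n / μ n) + 1) * μ n := by
        gcongr
        exact toNat_ceil_le (by positivity)
    _ = _ := by field_simp

lemma le_stepsBefore_mul {n : ℕ} (hm : 0 < μ n) (c : ℝ) :
    3 / 2 * Real.log n - c * logWindow μ s n - μ n ≤ stepsBefore μ s c n * μ n := by
  calc _ = (3 / 2 * (Real.log n / μ n) - c * (logWindow μ s n / μ n) - 1) * μ n := by field_simp
    _ ≤ _ := by
      gcongr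
      exact sub_one_le_toNat_floor _

lemma eventually_stepsAfter (h : LindebergShuffles p μ s) {c : ℝ} (hc : 0 ≤ c) :
    ∀ᶠ n : ℕ in atTop, Real.log n / μ n ≤ stepsAfter μ s c n ∧
      (stepsAfter μ s c n : ℝ) ≤ 3 * (Real.log n / μ n) := by
  filter_upwards [h.eventually_window_add_one_le c,
    h.tendsto_log_div_mean.eventually_ge_atTop 0] with n h1 h2
  have hm := (h.moments n).mean_pos
  have hw := logWindow_pos μ s n
  have h0 : 0 ≤ c * (logWindow μ s n / μ n) := by positivity
  have h3 := le_toNat_ceil (3 / 2 * (Real.log n / μ n) + c * (logWindow μ s n / μ n))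
  have h4 : (⌈3 / 2 * (Real.log n / μ n) + c * (logWindow μ s n / μ n)⌉.toNat : ℝ) ≤ _ :=
    toNat_ceil_le (by linarith)
  unfold stepsAfter
  constructor <;> linarith

lemma eventually_stepsBefore (h : LindebergShuffles p μ s) {c : ℝ} (hc : 0 ≤ c) :
    ∀ᶠ n : ℕ in atTop, Real.log n / μ n ≤ stepsBefore μ s c n ∧
      (stepsBefore μ s c n : ℝ) ≤ 3 * (Real.log n / μ n) ∧
      stepsBefore μ s c n * μ n ≤ 3 / 2 * Real.log n - c * logWindow μ s n := by
  filter_upwards [h.eventually_window_add_one_le c,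
    h.tendsto_log_div_mean.eventually_ge_atTop 0] with n h1 h2
  have hm := (h.moments n).mean_pos
  have hw := logWindow_pos μ s n
  have h0 : 0 ≤ c * (logWindow μ s n / μ n) := by positivity
  have h3 := sub_one_le_toNat_floor (3 / 2 * (Real.log n / μ n) - c * (logWindow μ s n / μ n))
  have h4 : (⌊3 / 2 * (Real.log n / μ n) - c * (logWindow μ s n / μ n)⌋.toNat : ℝ) ≤ _ :=
    toNat_floor_le (by linarith)
  unfold stepsBefore
  refine ⟨by linarith, by linarith, ?_⟩
  calc _ ≤ (3 / 2 * (Real.log n / μ n) - c * (logWindow μ s n / μ n)) * μ n := by gcongr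
    _ = _ := by field_simp

lemma eventually_threshold (C a : ℝ) :
    ∀ᶠ n : ℕ in atTop, 2 ≤ n ∧ C ≤ n ∧ 0 ≤ 3 / 2 * Real.log n + a := by
  have hlog : Tendsto (fun n : ℕ => 3 / 2 * Real.log n) atTop atTop :=
    (Real.tendsto_log_atTop.comp tendsto_natCast_atTop_atTop).const_mul_atTop (by norm_num)
  filter_upwards [eventually_ge_atTop 2, tendsto_natCast_atTop_atTop.eventually_ge_atTop C,
    hlog.eventually_ge_atTop (-a)] with n h1 h2 h3
  exact ⟨h1, h2, by linarith⟩

lemma eventually_tv_stepsAfter_le (h : LindebergShuffles p μ s) {c : ℝ} (hc : 0 < c) :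
    ∀ᶠ n : ℕ in atTop, tv n (iterConv n (Qp n (p n)) (stepsAfter μ s c n)) (Us n)
      ≤ 12 / c ^ 2 + √(Real.exp (8 * Real.exp (-2 * (c / 2))) - 1) := by
  filter_upwards [h.eventually_stepsAfter hc.le, h.tendsto_log_div_mean.eventually_ge_atTop 0,
    eventually_threshold (64 * Real.exp (-2 * (c / 2))) 0] with n hk hL hn
  have hw := logWindow_pos μ s n
  have hw1 := one_le_logWindow μ s n
  have hn1 : 1 ≤ n := by omega
  refine ((h.moments n).tv_iterConv_le_chebyshev hn1 (a := c * logWindow μ s n / 2)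
    (y := 3 / 2 * Real.log n + c / 2) (by positivity) ?_ (Real.sqrt_nonneg _)
    fun m _ hm => ?_).trans
    (add_le_add_left (mul_dev_sq_div_le hc (h.moments n).dev_pos hL hk.2) _)
  · have := le_stepsAfter_mul (s := s) (h.moments n).mean_pos c
    have : c * 1 ≤ c * logWindow μ s n := by gcongr
    linarith
  · obtain ⟨h1, h2⟩ := threshold_le_card hn1 hn.2.1 hm
    exact tv_Qs_le_sqrt hn1 h1 h2

lemma eventually_le_tv_stepsBefore (h : LindebergShuffles p μ s) {c : ℝ} (hc : 0 < c) :
    ∀ᶠ n : ℕ in atTop,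
      (1 - 12 / c ^ 2) * (1 - (√(1 + Real.exp (-2 * (-(c / 2))) / 192))⁻¹)
      ≤ tv n (iterConv n (Qp n (p n)) (stepsBefore μ s c n)) (Us n) := by
  filter_upwards [h.eventually_stepsBefore hc.le, h.tendsto_log_div_mean.eventually_ge_atTop 0,
    eventually_threshold (Real.exp (-2 * (-(c / 2)))) (-(c / 2))] with n hk hL hn
  have hw := logWindow_pos μ s n
  have hw1 := one_le_logWindow μ s n
  have hn1 : 1 ≤ n := by omega
  have hδ := one_sub_inv_sqrt_pos (x := Real.exp (-2 * (-(c / 2))) / 192) (by positivity)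
  refine le_trans ?_ ((h.moments n).le_tv_iterConv_chebyshev hn1 (a := c * logWindow μ s n / 2)
    (y := 3 / 2 * Real.log n + -(c / 2)) (by positivity) ?_ hn.2.2 hδ.le
    (le_tv_Qs_threshold hn.1 hn.2.1 hn.2.2))
  · have := mul_dev_sq_div_le hc (h.moments n).dev_pos hL hk.2.1
    gcongr
  · have : c * 1 ≤ c * logWindow μ s n := by gcongr
    linarith [hk.2.2]

lemma exists_pos_le_measure (h : LindebergShuffles p μ s) (D : ∀ n, PileSpace (p n))
    {k : ℕ → ℕ} (hk : ∀ᶠ n : ℕ in atTop, Real.log n / μ n ≤ k n)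
    {G : Set ℝ} (hG : IsOpen G) (hne : G.Nonempty) :
    ∃ δ, 0 < δ ∧ ∀ᶠ n in atTop, δ ≤ (D n).P.real
      {ω | (√(k n : ℝ))⁻¹ * ∑ i ∈ Finset.range (k n), (D n).Y (μ n) (s n) i ω ∈ G} := by
  refine exists_pos_le_measure_of_lindeberg (P := fun n => (D n).P)
    (Y := fun n => (D n).Y (μ n) (s n)) (fun n i => (D n).measurable_Y _ _ i)
    (fun n => (D n).indep_Y _ _) (fun n i => (D n).identDistrib_Y _ _ i 0)
    (fun n => PileSpace.memLp_Y (h.moments n) 0) (fun n => PileSpace.integral_Y (h.moments n) 0)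
    (fun n => PileSpace.integral_Y_sq (h.moments n) 0) ?_ hk (fun ε hε => ?_) hG hne
  · exact tendsto_natCast_atTop_iff.1 (tendsto_atTop_mono' _ hk h.tendsto_log_div_mean)
  · refine (h.lindeberg ε hε).congr fun n => ?_
    exact (PileSpace.integral_comp_X (D := D n) (h.moments n)
      (fun m : ℕ => if ε * (Real.log n / μ n) < ((Real.log m - μ n) / s n) ^ 2 then
        ((Real.log m - μ n) / s n) ^ 2 else 0) 0).symm

lemma logWindow_le_one_add {n k : ℕ} (hs : 0 < s n) (hk : Real.log n / μ n ≤ k) :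
    logWindow μ s n ≤ 1 + s n * √(k : ℝ) := by
  refine max_le ?_ ?_
  · have := Real.sqrt_nonneg (k : ℝ)
    nlinarith
  · have : s n * √(Real.log n / μ n) ≤ s n * √(k : ℝ) := by gcongr
    linarith

lemma sqrt_mul_normalized {k : ℕ} (hk : 0 < k) (x : ℝ) :
    √(k : ℝ) * ((√(k : ℝ))⁻¹ * x) = x := by
  have : 0 < √(k : ℝ) := by positivity
  field_simp

lemma exists_pos_le_tv_stepsAfter (h : LindebergShuffles p μ s) {b0 : ℝ} (hb0 : 0 < b0)
    (hb : ∀ n, b0 ≤ logWindow μ s n / μ n) {c : ℝ} (hc : 0 < c) :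
    ∃ δ, 0 < δ ∧ ∀ᶠ n : ℕ in atTop,
      δ ≤ tv n (iterConv n (Qp n (p n)) (stepsAfter μ s c n)) (Us n) := by
  have D : ∀ n, PileSpace (p n) := fun n => Classical.choice (h.moments n).nonempty_pileSpace
  set c' := c + 1 / b0 with hc'
  have hc0 : 0 < c' := by positivity
  have hsteps := h.eventually_stepsAfter hc.le
  obtain ⟨δ, hδ, hev⟩ := h.exists_pos_le_measure D (hsteps.mono fun n hn => hn.1)
    (isOpen_Iio (a := -c')) ⟨-c' - 1, by simp⟩
  have hx := one_sub_inv_sqrt_pos (x := Real.exp (-2 * c') / 192) (by positivity)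
  refine ⟨δ * (1 - (√(1 + Real.exp (-2 * c') / 192))⁻¹), by positivity, ?_⟩
  filter_upwards [hev, hsteps, h.tendsto_log_div_mean.eventually_gt_atTop 0,
    eventually_threshold (Real.exp (-2 * c')) c'] with n hn hk hL ht
  refine PileSpace.le_tv_iterConv (D := D n) (by omega) (h.moments n) _ hx.le ht.2.2
    (le_tv_Qs_threshold ht.1 ht.2.1 ht.2.2) (hn.trans (measureReal_mono fun ω hω => ?_))
  have hm := (h.moments n).mean_pos
  have hs := (h.moments n).dev_pos
  have hkpos : 0 < stepsAfter μ s c n := by exact_mod_cast hL.trans_le hk.1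
  rw [Set.mem_ofPred_eq, Set.mem_Iio] at hω
  rw [Set.mem_ofPred_eq, ← sqrt_mul_normalized hkpos (∑ i ∈ _, _)]
  have hmw : μ n ≤ 1 / b0 * logWindow μ s n := by
    have := hb n
    rw [le_div_iff₀ hm] at this
    rw [one_div, ← div_eq_inv_mul, le_div_iff₀ hb0]
    linarith
  have h1 := stepsAfter_mul_le (s := s) hm hc.le
  have h2 : c' * logWindow μ s n ≤ c' * (1 + s n * √(stepsAfter μ s c n : ℝ)) := by
    gcongr
    exact logWindow_le_one_add hs hk.1
  have h3 := mul_le_mul_of_nonneg_left hω.le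
    (by positivity : 0 ≤ s n * √(stepsAfter μ s c n : ℝ))
  rw [hc'] at h2 h3 ⊢
  linarith

lemma exists_tv_stepsBefore_le (h : LindebergShuffles p μ s) {b0 : ℝ} (hb0 : 0 < b0)
    (hb : ∀ n, b0 ≤ logWindow μ s n / μ n) {c : ℝ} (hc : 0 < c) :
    ∃ δ, 0 < δ ∧ ∀ᶠ n : ℕ in atTop,
      tv n (iterConv n (Qp n (p n)) (stepsBefore μ s c n)) (Us n) ≤ 1 - δ := by
  have D : ∀ n, PileSpace (p n) := fun n => Classical.choice (h.moments n).nonempty_pileSpace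
  set c' := c + 1 / b0 with hc'
  have hc0 : 0 < c' := by positivity
  have hsteps := h.eventually_stepsBefore hc.le
  obtain ⟨δ, hδ, hev⟩ := h.exists_pos_le_measure D (hsteps.mono fun n hn => hn.1)
    (isOpen_Ioi (a := c')) ⟨c' + 1, by simp⟩
  refine ⟨(Real.exp (8 * Real.exp (-2 * -c')) + 1)⁻¹ * δ, by positivity, ?_⟩
  filter_upwards [hev, hsteps, h.tendsto_log_div_mean.eventually_gt_atTop 0,
    eventually_threshold (64 * Real.exp (-2 * -c')) (-c')] with n hn hk hL ht
  have hn1 : 1 ≤ n := by omega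
  refine PileSpace.tv_iterConv_le (D := D n) (y := 3 / 2 * Real.log n + -c') hn1 (h.moments n) _
    (by positivity) (fun m _ hm => ?_) (hn.trans (measureReal_mono fun ω hω => ?_))
  · obtain ⟨h1, h2⟩ := threshold_le_card hn1 ht.2.1 hm
    exact tv_Qs_le_one_sub hn1 h1 h2
  have hm := (h.moments n).mean_pos
  have hs := (h.moments n).dev_pos
  have hkpos : 0 < stepsBefore μ s c n := by exact_mod_cast hL.trans_le hk.1
  rw [Set.mem_ofPred_eq, Set.mem_Ioi] at hω
  rw [Set.mem_ofPred_eq, ← sqrt_mul_normalized hkpos (∑ i ∈ _, _)]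
  have hmw : μ n ≤ 1 / b0 * logWindow μ s n := by
    have := hb n
    rw [le_div_iff₀ hm] at this
    rw [one_div, ← div_eq_inv_mul, le_div_iff₀ hb0]
    linarith
  have h1 := le_stepsBefore_mul (s := s) hm c
  have h2 : c' * logWindow μ s n ≤ c' * (1 + s n * √(stepsBefore μ s c n : ℝ)) := by
    gcongr
    exact logWindow_le_one_add hs hk.1
  have h3 := mul_le_mul_of_nonneg_left hω.le
    (by positivity : 0 ≤ s n * √(stepsBefore μ s c n : ℝ))
  rw [hc'] at h2 h3 ⊢
  linarith

end LindebergShuffles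

/-- Under the Lindeberg-type condition, the `p_n`-shuffle family presents a `(t_n, b_n)`
total variation cutoff, which is optimal whenever the window `b_n` is bounded below. -/
theorem pn_shuffle_cutoff_window (p : ℕ → ℕ → ℝ) (hp0 : ∀ n k, 0 ≤ p n k)
    (hpz : ∀ n, p n 0 = 0) (hpsum : ∀ n, ∑' k : ℕ, p n k = 1)
    (μ σ' : ℕ → ℝ) (hμpos : ∀ n, 0 < μ n) (hσpos : ∀ n, 0 < σ' n)
    (hsum1 : ∀ n, Summable fun k : ℕ => p n k * Real.log k)
    (hμ : ∀ n, μ n = ∑' k : ℕ, p n k * Real.log k)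
    (hsum2 : ∀ n, Summable fun k : ℕ => p n k * (Real.log k - μ n) ^ 2)
    (hσ : ∀ n, (σ' n) ^ 2 = ∑' k : ℕ, p n k * (Real.log k - μ n) ^ 2)
    (hLind : ∀ ε : ℝ, 0 < ε →
      Filter.Tendsto (fun n : ℕ => ∑' k : ℕ, p n k *
          (if ε * Real.log n / μ n < ((Real.log k - μ n) / σ' n) ^ 2 then
            ((Real.log k - μ n) / σ' n) ^ 2 else 0))
        Filter.atTop (nhds 0))
    (t b : ℕ → ℝ) (ht : ∀ n, t n = 3 * Real.log n / (2 * μ n))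
    (hb : ∀ n, b n = (1 / μ n) * max 1 (Real.sqrt ((σ' n) ^ 2 * Real.log n / μ n))) :
    Filter.Tendsto (fun n => b n / t n) Filter.atTop (nhds 0) ∧
    Filter.Tendsto (fun c : ℝ =>
      Filter.limsup (fun n : ℕ =>
        tv n (iterConv n (Qp n (p n)) (⌈t n + c * b n⌉).toNat) (Us n)) Filter.atTop)
      Filter.atTop (nhds 0) ∧
    Filter.Tendsto (fun c : ℝ =>
      Filter.liminf (fun n : ℕ =>
        tv n (iterConv n (Qp n (p n)) (⌊t n - c * b n⌋).toNat) (Us n)) Filter.atTop)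
      Filter.atTop (nhds 1) ∧
    ((∃ b0 : ℝ, 0 < b0 ∧ ∀ n, b0 ≤ b n) → ∀ c : ℝ, 0 < c →
      0 < Filter.liminf (fun n : ℕ =>
            tv n (iterConv n (Qp n (p n)) (⌈t n + c * b n⌉).toNat) (Us n)) Filter.atTop ∧
      Filter.limsup (fun n : ℕ =>
            tv n (iterConv n (Qp n (p n)) (⌊t n - c * b n⌋).toNat) (Us n)) Filter.atTop < 1) := by
  have h : LindebergShuffles p μ σ' :=
    ⟨fun n => ⟨hp0 n, hpz n, hpsum n, hμpos n, hσpos n, hsum1 n, hμ n, hsum2 n, hσ n⟩,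
      fun ε hε => by simpa only [mul_div_assoc] using hLind ε hε⟩
  have ht' : ∀ n, t n = 3 / 2 * (Real.log n / μ n) := fun n => by rw [ht]; ring
  have hb' : ∀ n, b n = logWindow μ σ' n / μ n := fun n => by
    rw [hb, mul_div_assoc, Real.sqrt_mul (by positivity), Real.sqrt_sq (hσpos n).le, logWindow]
    ring
  have hafter : ∀ c n, (⌈t n + c * b n⌉).toNat = LindebergShuffles.stepsAfter μ σ' c n :=
    fun c n => by rw [ht', hb', LindebergShuffles.stepsAfter]
  have hbefore : ∀ c n, (⌊t n - c * b n⌋).toNat = LindebergShuffles.stepsBefore μ σ' c n :=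
    fun c n => by rw [ht', hb', LindebergShuffles.stepsBefore]
  simp only [hafter, hbefore]
  have hge : ∀ k : ℕ → ℕ, ∀ᶠ n in atTop, 0 ≤ tv n (iterConv n (Qp n (p n)) (k n)) (Us n) :=
    fun k => Eventually.of_forall fun n => tv_nonneg _ _ _
  have hle : ∀ k : ℕ → ℕ, ∀ᶠ n in atTop, tv n (iterConv n (Qp n (p n)) (k n)) (Us n) ≤ 1 :=
    fun k => (eventually_ge_atTop 1).mono fun n hn => (h.moments n).tv_iterConv_le_one hn _
  have hcob : ∀ k : ℕ → ℕ, IsCoboundedUnder (· ≤ ·) atTop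
      fun n => tv n (iterConv n (Qp n (p n)) (k n)) (Us n) :=
    fun k => (isBoundedUnder_of_eventually_ge (hge k)).isCoboundedUnder_le
  have hcob' : ∀ k : ℕ → ℕ, IsCoboundedUnder (· ≥ ·) atTop
      fun n => tv n (iterConv n (Qp n (p n)) (k n)) (Us n) :=
    fun k => (isBoundedUnder_of_eventually_le (hle k)).isCoboundedUnder_ge
  have hsq : Tendsto (fun c : ℝ => 12 / c ^ 2) atTop (nhds 0) :=
    tendsto_const_nhds.div_atTop (tendsto_pow_atTop two_ne_zero)
  refine ⟨?_, ?_, ?_, ?_⟩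
  · refine tendsto_order.2 ⟨fun a ha => ?_, fun a ha => ?_⟩
    · filter_upwards [eventually_gt_atTop 1] with n hn
      have := logWindow_pos μ σ' n
      have := Real.log_natCast_nonneg n
      have := hμpos n
      rw [ht', hb']
      exact ha.trans_le (by positivity)
    · filter_upwards [eventually_gt_atTop 1, h.eventually_logWindow_le ha] with n hn hw
      have hlog : 0 < Real.log n := Real.log_pos (by exact_mod_cast hn)
      have := hμpos n
      rw [ht', hb', div_lt_iff₀ (by positivity), div_lt_iff₀ this]
      calc _ ≤ a * Real.log n := hw
        _ < 3 / 2 * (a * Real.log n) := by linarith [mul_pos ha hlog]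
        _ = _ := by field_simp
  · have hexp : Tendsto (fun c : ℝ => Real.exp (-2 * (c / 2))) atTop (nhds 0) := by
      simpa [mul_div_cancel₀] using Real.tendsto_exp_neg_atTop_nhds_zero
    have hbound : Tendsto (fun c : ℝ =>
        12 / c ^ 2 + √(Real.exp (8 * Real.exp (-2 * (c / 2))) - 1)) atTop (nhds 0) := by
      have hcont : Continuous fun x : ℝ => √(Real.exp (8 * x) - 1) := by fun_prop
      simpa using hsq.add ((hcont.tendsto 0).comp hexp)
    refine tendsto_of_tendsto_of_tendsto_of_le_of_le' tendsto_const_nhds hbound ?_ ?_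
    · refine Eventually.of_forall fun c => le_limsup_of_frequently_le (hge _).frequently
        (isBoundedUnder_of_eventually_le (hle _))
    · filter_upwards [eventually_gt_atTop 0] with c hc
      exact limsup_le_of_le (hcob _) (h.eventually_tv_stepsAfter_le hc)
  · have hexp : Tendsto (fun c : ℝ => 1 + Real.exp (-2 * (-(c / 2))) / 192) atTop atTop := by
      refine tendsto_atTop_add_const_left _ _ (Tendsto.atTop_div_const (by norm_num) ?_)
      simpa [mul_div_cancel₀] using Real.tendsto_exp_atTop
    have hbound : Tendsto (fun c : ℝ =>
        (1 - 12 / c ^ 2) * (1 - (√(1 + Real.exp (-2 * (-(c / 2))) / 192))⁻¹)) atTop (nhds 1) := by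
      simpa using (hsq.const_sub 1).mul
        ((tendsto_inv_atTop_zero.comp (Real.tendsto_sqrt_atTop.comp hexp)).const_sub 1)
    refine tendsto_of_tendsto_of_tendsto_of_le_of_le' hbound tendsto_const_nhds ?_ ?_
    · filter_upwards [eventually_gt_atTop 0] with c hc
      exact le_liminf_of_le (hcob' _) (h.eventually_le_tv_stepsBefore hc)
    · refine Eventually.of_forall fun c => liminf_le_of_frequently_le (hle _).frequently
        (isBoundedUnder_of_eventually_ge (hge _))
  · rintro ⟨b0, hb0, hbb⟩ c hc
    have hbb' : ∀ n, b0 ≤ logWindow μ σ' n / μ n := fun n => hb' n ▸ hbb n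
    obtain ⟨δ, hδ, hev⟩ := h.exists_pos_le_tv_stepsAfter hb0 hbb' hc
    obtain ⟨δ', hδ', hev'⟩ := h.exists_tv_stepsBefore_le hb0 hbb' hc
    exact ⟨hδ.trans_le (le_liminf_of_le (hcob' _) hev),
      (limsup_le_of_le (hcob _) hev').trans_lt (by linarith)⟩
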